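/- For any N×N complex matrices A and B, any partition λ with at most N parts, and any integer q, one has ∫_{U(N)} s_λ(U A U† B) (det U)^q d_*U = δ_{q,0} · s_λ(A) s_λ(B) / s_λ(I_N), i.e. the integral vanishes when q ≠ 0 and equals s_λ(A)s_λ(B)/s_λ(I_N) when q = 0. -/

import Mathlib

open scoped BigOperators Classical
open MeasureTheory Matrix

noncomputable section

/-- Complete homogeneous symmetric functions of the eigenvalues of `X`, defined through
Newton's identities from the power sums `p_m = Tr(X^m)`. -/
def hMat {N : ℕ} (X : Matrix (Fin N) (Fin N) ℂ) : ℕ → ℂ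
  | 0 => 1
  | (k+1) => ((k : ℂ) + 1)⁻¹ *
      ∑ m ∈ Finset.range (k+1), (X ^ (m+1)).trace * hMat X (k - m)
  termination_by k => k
  decreasing_by exact Nat.lt_succ_of_le (Nat.sub_le _ _)

def hMatZ {N : ℕ} (X : Matrix (Fin N) (Fin N) ℂ) (k : ℤ) : ℂ :=
  if k < 0 then 0 else hMat X k.toNat

/-- The Schur polynomial `s_λ(X)` of an `N×N` complex matrix `X`, evaluated at the
eigenvalues of `X`, via the Jacobi-Trudi formula `s_λ = det(h_{λ_i - i + j})`.
Here `l : Fin N → ℕ` lists the (at most `N`) parts of the partition `λ`. -/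
def schur {N : ℕ} (l : Fin N → ℕ) (X : Matrix (Fin N) (Fin N) ℂ) : ℂ :=
  (Matrix.of fun i j : Fin N => hMatZ X ((l i : ℤ) - (i : ℤ) + (j : ℤ))).det

/-- Partitions with at most `N` parts (weakly decreasing functions `Fin N → ℕ`). -/
def PartitionN (N : ℕ) := {l : Fin N → ℕ // Antitone l}

/-- The unitary group `U(N)`. -/
abbrev UN (N : ℕ) := Matrix.unitaryGroup (Fin N) ℂ

instance (N : ℕ) : MeasurableSpace (UN N) := borel _

instance borelSpace_UN (N : ℕ) : BorelSpace (UN N) := ⟨rfl⟩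

instance compactSpace_UN (N : ℕ) : CompactSpace (UN N) := by
  have hc : IsClosed (Matrix.unitaryGroup (Fin N) ℂ : Set (Matrix (Fin N) (Fin N) ℂ)) :=
    isClosed_unitary
  have hK : IsCompact (Set.pi Set.univ fun _ : Fin N => Set.pi Set.univ fun _ : Fin N =>
      Metric.closedBall (0 : ℂ) 1) :=
    isCompact_univ_pi fun _ => isCompact_univ_pi fun _ => isCompact_closedBall _ _
  refine isCompact_iff_compactSpace.mp (hK.of_isClosed_subset hc fun U hU i _ j _ => ?_)
  simpa using entry_norm_bound_of_unitary hU i j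

instance isMulRightInvariant_UN {N : ℕ} (μ : Measure (UN N)) [μ.IsHaarMeasure]
    [IsProbabilityMeasure μ] : μ.IsMulRightInvariant := by
  constructor
  intro g
  have : IsProbabilityMeasure (μ.map (· * g)) :=
    Measure.isProbabilityMeasure_map (by fun_prop)
  exact Measure.isHaarMeasure_eq_of_isProbabilityMeasure _ _

theorem integrable_UN {N : ℕ} (μ : Measure (UN N)) [IsProbabilityMeasure μ] (f : C(UN N, ℂ)) :
    Integrable f μ :=
  f.continuous.integrable_of_hasCompactSupport (HasCompactSupport.of_compactSpace _)

/-- On a finite-dimensional space of continuous functions, integration is a finite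
combination of point evaluations. -/
theorem exists_cubature {N : ℕ} (μ : Measure (UN N)) [IsProbabilityMeasure μ]
    {ι : Type*} [Finite ι] (w : ι → C(UN N, ℂ)) :
    ∃ a : UN N →₀ ℂ, ∀ i, ∫ U, w i U ∂μ = a.sum fun U r => r * w i U := by
  have := Fintype.ofFinite ι
  set v : ι → ℂ := fun i => ∫ U, w i U ∂μ with hv
  set e : UN N → ι → ℂ := fun U i => w i U with he
  have hmem : v ∈ Submodule.span ℂ (Set.range e) := by
    by_contra hnot
    obtain ⟨f, hf, hle⟩ := Submodule.exists_le_ker_of_notMem hnot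
    refine hf ?_
    have hfx : ∀ x : ι → ℂ, f x = ∑ i, f (Pi.single i 1) * x i := fun x => by
      conv_lhs => rw [LinearMap.pi_apply_eq_sum_univ f x]
      refine Finset.sum_congr rfl fun i _ => ?_
      rw [smul_eq_mul, mul_comm]
      congr 2
      ext j
      simp [Pi.single_apply, eq_comm]
    have hz : ∀ U, ∑ i, f (Pi.single i 1) * w i U = 0 := fun U => by
      rw [← hfx (e U)]
      exact hle (Submodule.subset_span ⟨U, rfl⟩)
    rw [hfx v]
    simp only [hv, ← integral_const_mul]
    rw [← integral_finsetSum _ fun i _ => (integrable_UN μ (w i)).const_mul _]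
    simp [hz]
  obtain ⟨a, ha⟩ := Finsupp.mem_span_range_iff_exists_finsupp.mp hmem
  refine ⟨a, fun i => ?_⟩
  have := congrFun ha i
  simp only [Finsupp.sum, Finset.sum_apply, Pi.smul_apply, smul_eq_mul] at this
  simpa only [hv, he, Finsupp.sum] using this.symm

/-- Evaluation of a polynomial in the entries at a matrix. -/
def ev {N : ℕ} (X : Matrix (Fin N) (Fin N) ℂ) :
    MvPolynomial (Fin N × Fin N) ℂ →ₐ[ℂ] ℂ :=
  MvPolynomial.aeval fun p => X p.1 p.2

@[simp] theorem ev_X {N : ℕ} (X : Matrix (Fin N) (Fin N) ℂ) (p : Fin N × Fin N) :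
    ev X (MvPolynomial.X p) = X p.1 p.2 := by simp [ev]

@[simp] theorem ev_C {N : ℕ} (X : Matrix (Fin N) (Fin N) ℂ) (r : ℂ) :
    ev X (MvPolynomial.C r) = r := by simp [ev]

theorem ev_ext {N : ℕ} {P Q : MvPolynomial (Fin N × Fin N) ℂ} (h : ∀ X, ev X P = ev X Q) :
    P = Q :=
  MvPolynomial.funext fun x => by
    simpa [ev, MvPolynomial.aeval_eq_eval] using h (Matrix.of fun i j => x (i, j))

/-- The substitution `X ↦ A * X * B`. -/
def transl {N : ℕ} (A B : Matrix (Fin N) (Fin N) ℂ) :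
    MvPolynomial (Fin N × Fin N) ℂ →ₐ[ℂ] MvPolynomial (Fin N × Fin N) ℂ :=
  MvPolynomial.aeval fun p =>
    ∑ i, ∑ j, MvPolynomial.C (A p.1 i * B j p.2) * MvPolynomial.X (i, j)

theorem ev_transl {N : ℕ} (A B X : Matrix (Fin N) (Fin N) ℂ)
    (P : MvPolynomial (Fin N × Fin N) ℂ) : ev X (transl A B P) = ev (A * X * B) P := by
  have : (ev X).comp (transl A B) = ev (A * X * B) := by
    refine MvPolynomial.algHom_ext fun p => ?_
    simp only [AlgHom.comp_apply, transl, MvPolynomial.aeval_X, map_sum, map_mul, ev_X, ev_C,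
      mul_apply, Finset.sum_mul]
    rw [Finset.sum_comm]
    exact Finset.sum_congr rfl fun _ _ => Finset.sum_congr rfl fun _ _ => by ring
  exact DFunLike.congr_fun this P

/-- Averages of two-sided translates of a polynomial are finite combinations of translates. -/
theorem exists_cubature_transl {N : ℕ} (μ : Measure (UN N)) [IsProbabilityMeasure μ]
    {A B : UN N → Matrix (Fin N) (Fin N) ℂ} (hA : Continuous A) (hB : Continuous B)
    (P : MvPolynomial (Fin N × Fin N) ℂ) :
    ∃ a : UN N →₀ ℂ, ∀ X, ∫ U, ev (A U * X * B U) P ∂μ =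
      a.sum fun U r => r * ev (A U * X * B U) P := by
  let q : Fin N × Fin N → MvPolynomial (Fin N × Fin N) C(UN N, ℂ) := fun p =>
    ∑ i, ∑ j, MvPolynomial.C (⟨fun U => A U p.1 i * B U j p.2, by fun_prop⟩ : C(UN N, ℂ)) *
      MvPolynomial.X (i, j)
  let T : MvPolynomial (Fin N × Fin N) C(UN N, ℂ) := MvPolynomial.aeval q P
  have hT : ∀ U X, ev (A U * X * B U) P =
      ∑ m ∈ T.support, (∏ p ∈ m.support, X p.1 p.2 ^ m p) * T.coeff m U := by
    intro U X
    let evU : C(UN N, ℂ) →ₐ[ℂ] ℂ := ContinuousMap.evalAlgHom ℂ ℂ U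
    have h1 : ∀ S : MvPolynomial (Fin N × Fin N) C(UN N, ℂ),
        MvPolynomial.eval₂ (evU : C(UN N, ℂ) →+* ℂ) (fun p => X p.1 p.2) S =
        ∑ m ∈ S.support, (∏ p ∈ m.support, X p.1 p.2 ^ m p) * S.coeff m U := fun S => by
      rw [MvPolynomial.eval₂_eq]
      exact Finset.sum_congr rfl fun m _ => mul_comm _ _
    rw [← h1]
    let F : MvPolynomial (Fin N × Fin N) C(UN N, ℂ) →ₐ[ℂ] ℂ :=
      { MvPolynomial.eval₂Hom (evU : C(UN N, ℂ) →+* ℂ) (fun p => X p.1 p.2) with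
        commutes' := fun r => by
          simp [MvPolynomial.algebraMap_apply, evU] }
    have : ev (A U * X * B U) = F.comp (MvPolynomial.aeval q) := by
      refine MvPolynomial.algHom_ext fun p => ?_
      simp only [AlgHom.comp_apply, MvPolynomial.aeval_X, ev_X, q, map_sum, map_mul]
      simp only [F, evU, AlgHom.coe_mk, MvPolynomial.coe_eval₂Hom, MvPolynomial.eval₂_C,
        MvPolynomial.eval₂_X, mul_apply, Finset.sum_mul]
      rw [Finset.sum_comm]
      exact Finset.sum_congr rfl fun _ _ => Finset.sum_congr rfl fun _ _ => by
        simp; ring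
    exact DFunLike.congr_fun this P
  obtain ⟨a, ha⟩ := exists_cubature μ fun m : T.support => T.coeff m
  refine ⟨a, fun X => ?_⟩
  simp only [hT]
  rw [integral_finsetSum _ fun m _ => (integrable_UN μ _).const_mul _]
  simp only [integral_const_mul, Finsupp.sum, Finset.mul_sum]
  rw [Finset.sum_comm]
  refine Finset.sum_congr rfl fun m hm => ?_
  have := ha ⟨m, hm⟩
  rw [this, Finsupp.sum, Finset.mul_sum]
  exact Finset.sum_congr rfl fun _ _ => by ring

section

open scoped ComplexOrder

/-- Restriction of a polynomial in the matrix entries to diagonal matrices. -/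
def diagSub {N : ℕ} : MvPolynomial (Fin N × Fin N) ℂ →ₐ[ℂ] MvPolynomial (Fin N) ℂ :=
  MvPolynomial.aeval fun p => if p.1 = p.2 then MvPolynomial.X p.1 else 0

theorem eval_diagSub {N : ℕ} (x : Fin N → ℂ) (P : MvPolynomial (Fin N × Fin N) ℂ) :
    MvPolynomial.aeval x (diagSub P) = ev (diagonal x) P := by
  have : (MvPolynomial.aeval x).comp diagSub = ev (diagonal x) := by
    refine MvPolynomial.algHom_ext fun p => ?_
    by_cases h : p.1 = p.2 <;> simp [diagSub, h]
  exact DFunLike.congr_fun this P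

/-- Restriction of a polynomial in the matrix entries to the line `t ↦ A + t • B`. -/
def lineSub {N : ℕ} (A B : Matrix (Fin N) (Fin N) ℂ) :
    MvPolynomial (Fin N × Fin N) ℂ →ₐ[ℂ] Polynomial ℂ :=
  MvPolynomial.aeval fun p => Polynomial.C (A p.1 p.2) + Polynomial.C (B p.1 p.2) * Polynomial.X

theorem eval_lineSub {N : ℕ} (A B : Matrix (Fin N) (Fin N) ℂ) (t : ℂ)
    (P : MvPolynomial (Fin N × Fin N) ℂ) :
    Polynomial.aeval t (lineSub A B P) = ev (A + t • B) P := by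
  have : (Polynomial.aeval t).comp (lineSub A B) = ev (A + t • B) := by
    refine MvPolynomial.algHom_ext fun p => ?_
    simp only [AlgHom.comp_apply, lineSub, MvPolynomial.aeval_X, ev_X, map_add, map_mul,
      Polynomial.aeval_C, Polynomial.aeval_X, Matrix.add_apply, Matrix.smul_apply, smul_eq_mul]
    simp [mul_comm]
  exact DFunLike.congr_fun this P

/-- Hermitian matrices are Zariski dense. -/
theorem eq_zero_of_isHermitian {N : ℕ} (P : MvPolynomial (Fin N × Fin N) ℂ)
    (h : ∀ H : Matrix (Fin N) (Fin N) ℂ, H.IsHermitian → ev H P = 0) : P = 0 := by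
  refine ev_ext fun X => ?_
  rw [map_zero]
  have hz : lineSub (realPart X : Matrix (Fin N) (Fin N) ℂ) (imaginaryPart X) P = 0 := by
    refine Polynomial.eq_zero_of_infinite_isRoot _
      (Set.Infinite.mono ?_ (Set.infinite_range_of_injective Complex.ofReal_injective))
    rintro _ ⟨t, rfl⟩
    have := eval_lineSub (realPart X : Matrix (Fin N) (Fin N) ℂ) (imaginaryPart X) t P
    rw [Polynomial.coe_aeval_eq_eval] at this
    refine this.trans (h _ ?_)
    have h1 : (realPart X : Matrix (Fin N) (Fin N) ℂ).IsHermitian := (realPart X).2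
    have h2 : (imaginaryPart X : Matrix (Fin N) (Fin N) ℂ).IsHermitian := (imaginaryPart X).2
    refine h1.add ?_
    rw [Matrix.IsHermitian, conjTranspose_smul, h2.eq]
    simp
  have := eval_lineSub (realPart X : Matrix (Fin N) (Fin N) ℂ) (imaginaryPart X) Complex.I P
  rwa [hz, map_zero, realPart_add_I_smul_imaginaryPart, eq_comm] at this

/-- The generic determinant. -/
def genDet (N : ℕ) : MvPolynomial (Fin N × Fin N) ℂ := (mvPolynomialX (Fin N) (Fin N) ℂ).det

theorem ev_genDet {N : ℕ} (X : Matrix (Fin N) (Fin N) ℂ) : ev X (genDet N) = X.det := by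
  rw [genDet, AlgHom.map_det, ev, mvPolynomialX_mapMatrix_aeval]

/-- Invertible matrices are Zariski dense. -/
theorem eq_zero_of_det_ne_zero {N : ℕ} (P : MvPolynomial (Fin N × Fin N) ℂ)
    (h : ∀ X : Matrix (Fin N) (Fin N) ℂ, X.det ≠ 0 → ev X P = 0) : P = 0 := by
  have : P * genDet N = 0 := by
    refine ev_ext fun X => ?_
    rw [map_mul, ev_genDet, map_zero]
    by_cases hX : X.det = 0
    · rw [hX, mul_zero]
    · rw [h X hX, zero_mul]
  exact (mul_eq_zero.mp this).resolve_right (det_mvPolynomialX_ne_zero _ _)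

theorem exists_unitary_mul_diagonal_mul_unitary {N : ℕ} (X : Matrix (Fin N) (Fin N) ℂ)
    (hX : X.det ≠ 0) : ∃ U ∈ unitaryGroup (Fin N) ℂ, ∃ V ∈ unitaryGroup (Fin N) ℂ,
      ∃ d : Fin N → ℂ, X = U * diagonal d * V := by
  have hpd : (Xᴴ * X).PosDef :=
    Matrix.PosDef.conjTranspose_mul_self X
      (mulVec_injective_of_isUnit ((isUnit_iff_isUnit_det X).mpr hX.isUnit))
  set V := (hpd.1.eigenvectorUnitary : Matrix (Fin N) (Fin N) ℂ) with hV
  have hVU : V ∈ unitaryGroup (Fin N) ℂ := hpd.1.eigenvectorUnitary.2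
  have hV1 : star V * V = 1 := (mem_unitaryGroup_iff').mp hVU
  have hV2 : V * star V = 1 := (mem_unitaryGroup_iff).mp hVU
  let d : Fin N → ℂ := fun i => (Real.sqrt (hpd.1.eigenvalues i) : ℂ)
  have hd : ∀ i, d i ≠ 0 := fun i => by
    simpa [d] using (Real.sqrt_pos.mpr (hpd.eigenvalues_pos i)).ne'
  have hdd : ∀ i, d i * d i = (hpd.1.eigenvalues i : ℂ) := fun i => by
    simp only [d]
    rw [← Complex.ofReal_mul, Real.mul_self_sqrt (hpd.eigenvalues_pos i).le]
  have hsp : Xᴴ * X = V * diagonal (fun i => d i * d i) * star V := by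
    conv_lhs => rw [hpd.1.spectral_theorem]
    simp only [hdd, Unitary.conjStarAlgAut_apply]
    rfl
  refine ⟨X * V * diagonal (fun i => (d i)⁻¹), ?_, star V, Unitary.star_mem hVU, d, ?_⟩
  · rw [mem_unitaryGroup_iff', star_eq_conjTranspose]
    rw [conjTranspose_mul, conjTranspose_mul, diagonal_conjTranspose]
    have : star (fun i => (d i)⁻¹) = fun i => (d i)⁻¹ := by
      ext i; simp [d]
    rw [this]
    calc diagonal (fun i => (d i)⁻¹) * (Vᴴ * Xᴴ) * (X * V * diagonal fun i => (d i)⁻¹)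
        = diagonal (fun i => (d i)⁻¹) * Vᴴ * (Xᴴ * X) * V * diagonal fun i => (d i)⁻¹ := by
          noncomm_ring
      _ = diagonal (fun i => (d i)⁻¹) * (star V * V) * diagonal (fun i => d i * d i) *
            (star V * V) * diagonal fun i => (d i)⁻¹ := by
          rw [hsp, ← star_eq_conjTranspose]; noncomm_ring
      _ = 1 := by
          rw [hV1]
          simp only [mul_one, diagonal_mul_diagonal]
          rw [← diagonal_one]
          congr 1
          ext i
          have := hd i
          field_simp
  · rw [mul_assoc (X * V), diagonal_mul_diagonal]
    have : (fun i => (d i)⁻¹ * d i) = fun _ => 1 := by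
      ext i; exact inv_mul_cancel₀ (hd i)
    rw [this, diagonal_one, mul_one, mul_assoc, hV2, mul_one]

/-- Unitary matrices are Zariski dense. -/
theorem eq_zero_of_unitary {N : ℕ} (P : MvPolynomial (Fin N × Fin N) ℂ)
    (h : ∀ U ∈ unitaryGroup (Fin N) ℂ, ev U P = 0) : P = 0 := by
  refine eq_zero_of_det_ne_zero P fun X hX => ?_
  obtain ⟨U, hU, V, hV, d, rfl⟩ := exists_unitary_mul_diagonal_mul_unitary X hX
  have hz : diagSub (transl U V P) = 0 := by
    refine MvPolynomial.funext_set (fun _ => {z : ℂ | ‖z‖ = 1}) (fun _ => ?_) fun z hz => ?_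
    · have : Set.Infinite (Metric.sphere (0 : ℂ) 1) := by
        have := (isConnected_sphere (E := ℂ) (by simp) 0 zero_le_one).isPreconnected.infinite_of_nontrivial
        refine this ⟨1, by simp, -1, by simp, ?_⟩
        norm_num
      refine this.mono fun z hz => by simpa using hz
    · rw [map_zero, ← MvPolynomial.aeval_eq_eval, eval_diagSub, ev_transl]
      refine h _ (mul_mem (mul_mem hU ?_) hV)
      rw [mem_unitaryGroup_iff, star_eq_conjTranspose, diagonal_conjTranspose,
        diagonal_mul_diagonal, ← diagonal_one]
      congr 1
      ext i
      have : ‖z i‖ = 1 := hz i trivial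
      simp [Complex.mul_conj, Complex.normSq_eq_norm_sq, this]
  rw [← ev_transl, ← eval_diagSub, hz, map_zero]

end

/-- The chain rule for derivations. -/
theorem derivation_aeval {σ A : Type*} [Fintype σ] [CommRing A] [Algebra ℂ A]
    (D : Derivation ℂ A A) (q : σ → A) (P : MvPolynomial σ ℂ) :
    D (MvPolynomial.aeval q P) =
      ∑ p, MvPolynomial.aeval q (MvPolynomial.pderiv p P) * D (q p) := by
  induction P using MvPolynomial.induction_on with
  | C r => simp [MvPolynomial.algHom_C]
  | add P Q hP hQ => simp [hP, hQ, add_mul, Finset.sum_add_distrib]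
  | mul_X P p hP =>
    simp only [map_mul, MvPolynomial.aeval_X, Derivation.leibniz, smul_eq_mul, hP, map_add,
      MvPolynomial.pderiv_X, add_mul, Finset.sum_add_distrib]
    congr 1
    · rw [Finset.sum_eq_single p]
      · simp
      · intro b _ hb
        simp [hb.symm]
      · simp
    · rw [Finset.mul_sum]
      exact Finset.sum_congr rfl fun _ _ => by ring

/-- The leading principal minor on the rows and columns `≤ m`. -/
def minor {N : ℕ} (m : Fin N) : MvPolynomial (Fin N × Fin N) ℂ :=
  (toSquareBlockProp (mvPolynomialX (Fin N) (Fin N) ℂ) (· ≤ m)).det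

theorem ev_minor {N : ℕ} (m : Fin N) (X : Matrix (Fin N) (Fin N) ℂ) :
    ev X (minor m) = (toSquareBlockProp X (· ≤ m)).det := by
  rw [minor, AlgHom.map_det]
  congr 1
  ext i j
  simp [toSquareBlockProp]

theorem sum_subtype_le_of_eq_zero {N : ℕ} (m : Fin N) (f : Fin N → ℂ)
    (hf : ∀ i, m < i → f i = 0) : ∑ i : {i // i ≤ m}, f i = ∑ i, f i := by
  rw [← Finset.sum_subtype (Finset.Iic m) (fun _ => Finset.mem_Iic) f]
  exact Finset.sum_subset (Finset.subset_univ _) fun i _ hi => hf i (by simpa using hi)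

theorem minor_mul_upper {N : ℕ} (m : Fin N) (X B : Matrix (Fin N) (Fin N) ℂ)
    (hB : ∀ i j, j < i → B i j = 0) :
    ev (X * B) (minor m) = ev X (minor m) * ev B (minor m) := by
  rw [ev_minor, ev_minor, ev_minor, ← det_mul]
  congr 1
  ext i j
  simp only [toSquareBlockProp, toBlock_apply, mul_apply]
  exact (sum_subtype_le_of_eq_zero m (fun k => X i k * B k j) fun k hk => by
    rw [hB k j (j.2.trans_lt hk), mul_zero]).symm

theorem minor_lower_mul {N : ℕ} (m : Fin N) (L X : Matrix (Fin N) (Fin N) ℂ)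
    (hL : ∀ i j, i < j → L i j = 0) :
    ev (L * X) (minor m) = ev L (minor m) * ev X (minor m) := by
  rw [ev_minor, ev_minor, ev_minor, ← det_mul]
  congr 1
  ext i j
  simp only [toSquareBlockProp, toBlock_apply, mul_apply]
  exact (sum_subtype_le_of_eq_zero m (fun k => L i k * X k j) fun k hk => by
    rw [hL i k (i.2.trans_lt hk), zero_mul]).symm

theorem minor_upper {N : ℕ} (m : Fin N) (B : Matrix (Fin N) (Fin N) ℂ)
    (hB : ∀ i j, j < i → B i j = 0) :
    ev B (minor m) = ∏ i ∈ Finset.Iic m, B i i := by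
  rw [ev_minor, det_of_isUpperTriangular]
  · exact (Finset.prod_subtype (Finset.Iic m) (fun _ => Finset.mem_Iic) fun i => B i i).symm
  · exact fun i j hij => hB i j hij

theorem minor_one {N : ℕ} (m : Fin N) : ev 1 (minor m) = 1 := by
  rw [minor_upper m 1 fun i j h => one_apply_ne h.ne']
  simp

/-- The highest weight function `∏ Δ_m ^ c_m`. -/
def hw {N : ℕ} (c : Fin N → ℕ) : MvPolynomial (Fin N × Fin N) ℂ := ∏ m, minor m ^ c m

theorem hw_one {N : ℕ} (c : Fin N → ℕ) : ev 1 (hw c) = 1 := by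
  simp [hw, minor_one]

theorem hw_mul_upper {N : ℕ} (c : Fin N → ℕ) (X B : Matrix (Fin N) (Fin N) ℂ)
    (hB : ∀ i j, j < i → B i j = 0) : ev (X * B) (hw c) = ev X (hw c) * ev B (hw c) := by
  simp only [hw, map_prod, map_pow, minor_mul_upper _ X B hB, mul_pow, Finset.prod_mul_distrib]

theorem hw_lower_mul {N : ℕ} (c : Fin N → ℕ) (L X : Matrix (Fin N) (Fin N) ℂ)
    (hL : ∀ i j, i < j → L i j = 0) : ev (L * X) (hw c) = ev L (hw c) * ev X (hw c) := by
  simp only [hw, map_prod, map_pow, minor_lower_mul _ L X hL, mul_pow, Finset.prod_mul_distrib]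

theorem hw_upper {N : ℕ} (c : Fin N → ℕ) (B : Matrix (Fin N) (Fin N) ℂ)
    (hB : ∀ i j, j < i → B i j = 0) :
    ev B (hw c) = ∏ i, B i i ^ (∑ m ∈ Finset.Ici i, c m) := by
  simp only [hw, map_prod, map_pow, minor_upper _ B hB, ← Finset.prod_pow,
    ← Finset.prod_pow_eq_pow_sum]
  refine Finset.prod_comm' fun m i => ?_
  simp

/-- A matrix with nonzero leading principal minors can be brought to unipotent upper
triangular form by a lower triangular matrix. -/
theorem exists_lower_mul_eq_upper {N : ℕ} (X : Matrix (Fin N) (Fin N) ℂ)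
    (hX : ∀ m : Fin N, ev X (minor m) ≠ 0) : ∃ L : Matrix (Fin N) (Fin N) ℂ,
      (∀ i j, i < j → L i j = 0) ∧ (∀ i j, j < i → (L * X) i j = 0) ∧
      ∀ i, (L * X) i i = 1 := by
  let L : Matrix (Fin N) (Fin N) ℂ := of fun k j =>
    if h : j ≤ k then (toSquareBlockProp X (· ≤ k))⁻¹ ⟨k, le_rfl⟩ ⟨j, h⟩ else 0
  have hL : ∀ i j, i < j → L i j = 0 := fun i j h => by simp [L, h.not_ge]
  have key : ∀ k l (h : l ≤ k), (L * X) k l =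
      (1 : Matrix {i // i ≤ k} {i // i ≤ k} ℂ) ⟨k, le_rfl⟩ ⟨l, h⟩ := fun k l h => by
    have hdet : IsUnit (toSquareBlockProp X (· ≤ k)).det := by
      rw [← ev_minor]; exact (hX k).isUnit
    rw [← nonsing_inv_mul _ hdet, mul_apply, mul_apply,
      ← sum_subtype_le_of_eq_zero k _ fun j hj => by rw [hL k j hj, zero_mul]]
    refine Finset.sum_congr rfl fun j _ => ?_
    congr 1
    simp [L, j.2]
  refine ⟨L, hL, fun i j h => ?_, fun i => ?_⟩
  · rw [key i j h.le, one_apply_ne]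
    simpa using h.ne'
  · rw [key i i le_rfl, one_apply_eq]

/-- Uniqueness of highest weight functions. -/
theorem eq_hw_of_equivariant {N : ℕ} (c : Fin N → ℕ) (P : MvPolynomial (Fin N × Fin N) ℂ)
    (hl : ∀ L X : Matrix (Fin N) (Fin N) ℂ, (∀ i j, i < j → L i j = 0) →
      ev (L * X) P = ev L (hw c) * ev X P)
    (hr : ∀ X B : Matrix (Fin N) (Fin N) ℂ, (∀ i j, j < i → B i j = 0) →
      ev (X * B) P = ev X P * ev B (hw c)) (X : Matrix (Fin N) (Fin N) ℂ) :
    ev X P = ev 1 P * ev X (hw c) := by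
  have hM : (∏ m : Fin N, minor m) ≠ (0 : MvPolynomial (Fin N × Fin N) ℂ) := fun h => by
    have := congrArg (ev 1) h
    simp [minor_one] at this
  have : (P - MvPolynomial.C (ev 1 P) * hw c) * ∏ m : Fin N, minor m = 0 := by
    refine ev_ext fun X => ?_
    rw [map_mul, map_zero]
    by_cases hX : ∀ m : Fin N, ev X (minor m) ≠ 0
    · obtain ⟨L, hL, hU, h1⟩ := exists_lower_mul_eq_upper X hX
      have e1 : ev (L * X) (hw c) = 1 := by rw [hw_upper c _ hU]; simp [h1]
      have e2 := hw_lower_mul c L X hL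
      have e3 := hl L X hL
      have e4 := hr 1 (L * X) hU
      rw [one_mul, e1, mul_one] at e4
      rw [e1] at e2
      rw [e4] at e3
      refine mul_eq_zero_of_left ?_ _
      rw [map_sub, map_mul, ev_C]
      linear_combination (ev X P) * e2 + (- ev X (hw c)) * e3
    · push Not at hX
      obtain ⟨m, hm⟩ := hX
      rw [map_prod, Finset.prod_eq_zero (Finset.mem_univ m) hm, mul_zero]
  have := (mul_eq_zero.mp this).resolve_right hM
  have := congrArg (ev X) this
  rw [map_sub, map_mul, ev_C, map_zero, sub_eq_zero] at this
  exact this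

open MvPolynomial in
theorem pderiv_pderiv_comm {σ : Type*} (p q : σ) (P : MvPolynomial σ ℂ) :
    pderiv p (pderiv q P) = pderiv q (pderiv p P) := by
  have : ⁅pderiv (R := ℂ) (σ := σ) p, pderiv q⁆ =
      (0 : Derivation ℂ (MvPolynomial σ ℂ) (MvPolynomial σ ℂ)) := by
    refine MvPolynomial.derivation_ext fun i => ?_
    rw [Derivation.commutator_apply]
    rw [pderiv_X, pderiv_X, Pi.single_apply, Pi.single_apply]
    split_ifs <;> simp
  have := DFunLike.congr_fun this P
  rwa [Derivation.commutator_apply, Derivation.zero_apply, sub_eq_zero] at this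

theorem eval_derivative_lineSub {N : ℕ} (A B : Matrix (Fin N) (Fin N) ℂ)
    (P : MvPolynomial (Fin N × Fin N) ℂ) :
    Polynomial.aeval (0 : ℂ) (Polynomial.derivative (lineSub A B P)) =
      ∑ p : Fin N × Fin N, ev A (MvPolynomial.pderiv p P) * B p.1 p.2 := by
  have h := derivation_aeval (Polynomial.derivative' (R := ℂ)) (fun p : Fin N × Fin N =>
    Polynomial.C (A p.1 p.2) + Polynomial.C (B p.1 p.2) * Polynomial.X) P
  change Polynomial.aeval (0 : ℂ) (Polynomial.derivative' (lineSub A B P)) = _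
  rw [lineSub, h, map_sum]
  refine Finset.sum_congr rfl fun p _ => ?_
  have h2 := eval_lineSub A B 0 (MvPolynomial.pderiv p P)
  rw [lineSub, zero_smul, add_zero] at h2
  rw [map_mul, h2]
  simp [Polynomial.derivative']

/-- The infinitesimal right translation by the matrix unit `e_ij`. -/
def rOp {N : ℕ} (i j : Fin N) (P : MvPolynomial (Fin N × Fin N) ℂ) :
    MvPolynomial (Fin N × Fin N) ℂ :=
  ∑ k, MvPolynomial.X (k, i) * MvPolynomial.pderiv (k, j) P

theorem ev_rOp {N : ℕ} (i j : Fin N) (P : MvPolynomial (Fin N × Fin N) ℂ)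
    (X : Matrix (Fin N) (Fin N) ℂ) : ev X (rOp i j P) =
      Polynomial.aeval (0 : ℂ) (Polynomial.derivative (lineSub X (X * single i j 1) P)) := by
  rw [eval_derivative_lineSub, Fintype.sum_prod_type, rOp, map_sum]
  refine Finset.sum_congr rfl fun k _ => ?_
  rw [Finset.sum_eq_single j]
  · simp [mul_comm]
  · intro b _ hb
    simp [mul_single_apply_of_ne, hb]
  · simp

theorem hw_rOp {N : ℕ} (c : Fin N → ℕ) (i j : Fin N) (hij : i ≤ j) :
    rOp i j (hw c) =
      MvPolynomial.C (if i = j then ((∑ m ∈ Finset.Ici i, c m : ℕ) : ℂ) else 0) * hw c := by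
  refine ev_ext fun X => ?_
  have hB : ∀ t : ℂ, ∀ a b : Fin N, b < a →
      (1 + t • single i j 1 : Matrix (Fin N) (Fin N) ℂ) a b = 0 := by
    intro t a b hab
    have : ¬ (i = a ∧ j = b) := by rintro ⟨rfl, rfl⟩; exact absurd hab hij.not_gt
    simp [one_apply_ne hab.ne', this]
  have : lineSub X (X * single i j 1) (hw c) = Polynomial.C (ev X (hw c)) *
      (1 + if i = j then Polynomial.X else 0) ^ (∑ m ∈ Finset.Ici i, c m) := by
    refine Polynomial.funext fun t => ?_
    have h1 := eval_lineSub X (X * single i j 1) t (hw c)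
    rw [Polynomial.coe_aeval_eq_eval] at h1
    rw [h1]
    have h2 : X + t • (X * single i j 1) = X * (1 + t • single i j 1) := by
      rw [mul_add, mul_one, mul_smul_comm]
    rw [h2, hw_mul_upper c _ _ (hB t), hw_upper c _ (hB t), Finset.prod_eq_single i]
    · split_ifs with h
      · subst h; simp
      · simp [Ne.symm h]
    · intro b _ hb
      simp [Ne.symm hb]
    · simp
  rw [ev_rOp, this, map_mul (ev X), ev_C]
  split_ifs with h
  · have h0 : Polynomial.eval 0 (∑ m ∈ Finset.Ici i, (c m : Polynomial ℂ)) =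
        ∑ m ∈ Finset.Ici i, (c m : ℂ) := by simp [Polynomial.eval_finsetSum]
    simp [mul_comm, Polynomial.derivative_pow, h0]
  · simp

/-- The normally ordered quadratic Casimir operator. -/
def cas {N : ℕ} (P : MvPolynomial (Fin N × Fin N) ℂ) : MvPolynomial (Fin N × Fin N) ℂ :=
  ∑ q : Fin N × Fin N, ∑ r : Fin N × Fin N,
    MvPolynomial.X (r.1, q.2) * MvPolynomial.X (q.1, r.2) *
      MvPolynomial.pderiv r (MvPolynomial.pderiv q P)

def casPart {N : ℕ} (i j : Fin N) (P : MvPolynomial (Fin N × Fin N) ℂ) :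
    MvPolynomial (Fin N × Fin N) ℂ :=
  ∑ l, ∑ k, MvPolynomial.X (k, i) * MvPolynomial.X (l, j) *
      MvPolynomial.pderiv (k, j) (MvPolynomial.pderiv (l, i) P)

theorem cas_eq {N : ℕ} (P : MvPolynomial (Fin N × Fin N) ℂ) :
    cas P = ∑ i, ∑ j, casPart i j P := by
  simp only [cas, casPart, Fintype.sum_prod_type]
  rw [Finset.sum_comm]
  refine Finset.sum_congr rfl fun i _ => ?_
  rw [Finset.sum_comm' (t' := Finset.univ) (s' := fun _ => Finset.univ) (by simp)]
  conv_rhs => rw [Finset.sum_comm]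
  rw [Finset.sum_comm]
  refine Finset.sum_congr rfl fun k _ => ?_
  rw [Finset.sum_comm]

theorem casPart_comm {N : ℕ} (i j : Fin N) (P : MvPolynomial (Fin N × Fin N) ℂ) :
    casPart i j P = casPart j i P := by
  rw [casPart, Finset.sum_comm]
  refine Finset.sum_congr rfl fun l _ => Finset.sum_congr rfl fun k _ => ?_
  rw [pderiv_pderiv_comm]
  ring

theorem rOp_rOp {N : ℕ} (i j : Fin N) (P : MvPolynomial (Fin N × Fin N) ℂ) :
    rOp i j (rOp j i P) = casPart i j P + rOp i i P := by
  have h : ∀ k, MvPolynomial.pderiv (k, j) (rOp j i P) =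
      ∑ l, MvPolynomial.X (l, j) *
        MvPolynomial.pderiv (k, j) (MvPolynomial.pderiv (l, i) P) +
      MvPolynomial.pderiv (k, i) P := by
    intro k
    rw [rOp, map_sum]
    simp only [Derivation.leibniz, smul_eq_mul, Finset.sum_add_distrib]
    congr 1
    rw [Finset.sum_eq_single k]
    · rw [MvPolynomial.pderiv_X_self, mul_one]
    · intro b _ hb
      rw [MvPolynomial.pderiv_X_of_ne (by simpa using hb), mul_zero]
    · simp
  unfold casPart
  rw [Finset.sum_comm]
  conv_lhs => unfold rOp
  conv_rhs => arg 2; unfold rOp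
  rw [← Finset.sum_add_distrib]
  refine Finset.sum_congr rfl fun k _ => ?_
  have := congrArg (fun Q => MvPolynomial.X (k, i) * Q) (h k)
  unfold rOp at this
  refine this.trans ((mul_add _ _ _).trans (congrArg₂ (· + ·) ?_ rfl))
  rw [Finset.mul_sum]
  exact Finset.sum_congr rfl fun l _ => (mul_assoc _ _ _).symm

theorem rOp_C_mul {N : ℕ} (i j : Fin N) (a : ℂ) (P : MvPolynomial (Fin N × Fin N) ℂ) :
    rOp i j (MvPolynomial.C a * P) = MvPolynomial.C a * rOp i j P := by
  simp only [rOp, MvPolynomial.pderiv_C_mul, Finset.mul_sum]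
  exact Finset.sum_congr rfl fun l _ => by ring

theorem cas_hw {N : ℕ} (c l : Fin N → ℕ) (hl : ∀ i, l i = ∑ m ∈ Finset.Ici i, c m) :
    cas (hw c) = MvPolynomial.C (∑ i : Fin N, ((l i : ℂ) * (l i - 1) - 2 * (i : ℕ) * l i)) *
      hw c := by
  have hlt : ∀ i j : Fin N, i < j → casPart i j (hw c) = MvPolynomial.C (-(l j : ℂ)) * hw c := by
    intro i j hij
    have h := rOp_rOp j i (hw c)
    rw [hw_rOp c i j hij.le, if_neg hij.ne, hw_rOp c j j le_rfl, if_pos rfl, rOp_C_mul, ← hl,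
      ← casPart_comm] at h
    simp only [map_zero, zero_mul] at h
    rw [map_neg]
    linear_combination -h
  have hdiag : ∀ i : Fin N, casPart i i (hw c) =
      MvPolynomial.C ((l i : ℂ) * (l i - 1)) * hw c := by
    intro i
    have h := rOp_rOp i i (hw c)
    rw [hw_rOp c i i le_rfl, if_pos rfl, rOp_C_mul, ← hl, hw_rOp c i i le_rfl, if_pos rfl,
      ← hl] at h
    rw [map_mul, map_sub, map_one]
    linear_combination -h
  have hall : ∀ i j : Fin N, casPart i j (hw c) =
      MvPolynomial.C ((if i = j then (l i : ℂ) * (l i - 1) else 0) +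
        ((if i < j then -(l j : ℂ) else 0) + if j < i then -(l i : ℂ) else 0)) * hw c := by
    intro i j
    rcases lt_trichotomy i j with h | h | h
    · simp [hlt i j h, h, h.ne, h.not_gt]
    · subst h; simp [hdiag]
    · rw [casPart_comm, hlt j i h]; simp [h, h.ne', h.not_gt]
  rw [cas_eq]
  simp only [hall, ← Finset.sum_mul, ← map_sum]
  congr 2
  simp only [Finset.sum_add_distrib, Finset.sum_ite_eq, Finset.mem_univ, if_true]
  rw [Finset.sum_comm (f := fun i j : Fin N => if i < j then -(l j : ℂ) else 0)]
  simp only [← Finset.sum_add_distrib]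
  refine Finset.sum_congr rfl fun i _ => ?_
  rw [Finset.sum_add_distrib, ← Finset.sum_filter, Finset.sum_const]
  have : (Finset.univ.filter fun x : Fin N => x < i).card = i := by
    rw [← Fin.card_Iio i]
    congr 1
    ext x
    simp
  rw [this, nsmul_eq_mul]
  ring

theorem pderiv_transl {N : ℕ} (A B : Matrix (Fin N) (Fin N) ℂ)
    (P : MvPolynomial (Fin N × Fin N) ℂ) (p : Fin N × Fin N) :
    MvPolynomial.pderiv p (transl A B P) = ∑ q : Fin N × Fin N,
      MvPolynomial.C (A q.1 p.1 * B p.2 q.2) * transl A B (MvPolynomial.pderiv q P) := by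
  rw [transl, derivation_aeval]
  refine Finset.sum_congr rfl fun q _ => ?_
  rw [mul_comm]
  congr 1
  simp only [map_sum, MvPolynomial.pderiv_C_mul]
  rw [Finset.sum_eq_single p.1, Finset.sum_eq_single p.2]
  · rw [MvPolynomial.pderiv_X_self, mul_one]
  · intro b _ hb
    rw [MvPolynomial.pderiv_X_of_ne (fun h => hb (congrArg Prod.snd h)), mul_zero]
  · simp
  · intro b _ hb
    refine Finset.sum_eq_zero fun c _ => ?_
    rw [MvPolynomial.pderiv_X_of_ne (fun h => hb (congrArg Prod.fst h)), mul_zero]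
  · simp

theorem transl_X {N : ℕ} (A B : Matrix (Fin N) (Fin N) ℂ) (i j : Fin N) :
    transl A B (MvPolynomial.X (i, j)) =
      ∑ k, ∑ l, MvPolynomial.C (A i k * B l j) * MvPolynomial.X (k, l) := by
  rw [transl, MvPolynomial.aeval_X]

theorem cas_add {N : ℕ} (P Q : MvPolynomial (Fin N × Fin N) ℂ) :
    cas (P + Q) = cas P + cas Q := by
  simp only [cas, map_add, mul_add, Finset.sum_add_distrib]

theorem cas_C_mul {N : ℕ} (a : ℂ) (P : MvPolynomial (Fin N × Fin N) ℂ) :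
    cas (MvPolynomial.C a * P) = MvPolynomial.C a * cas P := by
  simp only [cas, MvPolynomial.pderiv_C_mul, Finset.mul_sum]
  exact Finset.sum_congr rfl fun _ _ => Finset.sum_congr rfl fun _ _ => by ring

theorem cas_sum {N : ℕ} {ι : Type*} (s : Finset ι)
    (f : ι → MvPolynomial (Fin N × Fin N) ℂ) : cas (∑ i ∈ s, f i) = ∑ i ∈ s, cas (f i) := by
  induction s using Finset.induction_on with
  | empty => simp [cas]
  | insert a s ha ih => rw [Finset.sum_insert ha, Finset.sum_insert ha, cas_add, ih]

theorem sum_sum_sum_swap {ι M : Type*} [Fintype ι] [AddCommMonoid M] (F : ι → ι → ι → M) :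
    ∑ a, ∑ b, ∑ c, F a b c = ∑ c, ∑ b, ∑ a, F a b c := by
  rw [Finset.sum_congr rfl fun a _ => Finset.sum_comm, Finset.sum_comm]
  exact Finset.sum_congr rfl fun c _ => Finset.sum_comm

theorem cas_transl {N : ℕ} (A B : Matrix (Fin N) (Fin N) ℂ)
    (P : MvPolynomial (Fin N × Fin N) ℂ) :
    cas (transl A B P) = transl A B (cas P) := by
  have h : ∀ q r : Fin N × Fin N,
      MvPolynomial.pderiv r (MvPolynomial.pderiv q (transl A B P)) =
      ∑ s : Fin N × Fin N, ∑ t : Fin N × Fin N,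
        MvPolynomial.C (A s.1 q.1 * B q.2 s.2) * (MvPolynomial.C (A t.1 r.1 * B r.2 t.2) *
          transl A B (MvPolynomial.pderiv t (MvPolynomial.pderiv s P))) := by
    intro q r
    rw [pderiv_transl, map_sum]
    refine Finset.sum_congr rfl fun s _ => ?_
    rw [MvPolynomial.pderiv_C_mul, pderiv_transl, Finset.mul_sum]
  simp only [cas, map_sum, map_mul, h, Finset.mul_sum]
  rw [Finset.sum_congr rfl fun q _ => Finset.sum_comm, Finset.sum_comm]
  refine Finset.sum_congr rfl fun s _ => ?_
  rw [Finset.sum_congr rfl fun q _ => Finset.sum_comm, Finset.sum_comm]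
  refine Finset.sum_congr rfl fun t _ => ?_
  simp only [← Finset.sum_mul, ← mul_assoc]
  congr 1
  rw [transl_X, transl_X]
  simp only [Fintype.sum_prod_type]
  rw [sum_sum_sum_swap, Finset.sum_mul]
  refine Finset.sum_congr rfl fun k _ => ?_
  rw [Finset.sum_mul]
  refine Finset.sum_congr rfl fun l _ => ?_
  rw [Finset.mul_sum]
  refine Finset.sum_congr rfl fun k' _ => ?_
  rw [Finset.mul_sum]
  refine Finset.sum_congr rfl fun l' _ => ?_
  simp only [map_mul]
  ring

theorem sum_X_mul_pderiv_row_eq_rOp {N : ℕ} (P : MvPolynomial (Fin N × Fin N) ℂ)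
    (hP : ∀ g X, ev (g * X) P = ev (X * g) P) (i j : Fin N) :
    ∑ l, MvPolynomial.X (j, l) * MvPolynomial.pderiv (i, l) P = rOp i j P := by
  refine ev_ext fun X => ?_
  have h : lineSub X (single i j 1 * X) P = lineSub X (X * single i j 1) P := by
    refine Polynomial.funext fun t => ?_
    rw [← Polynomial.coe_aeval_eq_eval, eval_lineSub, eval_lineSub]
    have := hP (1 + t • single i j 1) X
    rwa [add_mul, mul_add, one_mul, mul_one, smul_mul_assoc, mul_smul_comm] at this
  rw [ev_rOp, ← h, eval_derivative_lineSub, Fintype.sum_prod_type, map_sum]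
  symm
  rw [Finset.sum_eq_single i]
  · exact Finset.sum_congr rfl fun l _ => by simp [mul_comm]
  · intro b _ hb
    exact Finset.sum_eq_zero fun l _ => by simp [single_mul_apply_of_ne, hb]
  · simp

theorem diagSub_X {N : ℕ} (i j : Fin N) :
    diagSub (MvPolynomial.X (i, j)) = if i = j then MvPolynomial.X i else 0 := by
  rw [diagSub, MvPolynomial.aeval_X]

theorem pderiv_diagSub {N : ℕ} (P : MvPolynomial (Fin N × Fin N) ℂ) (i : Fin N) :
    MvPolynomial.pderiv i (diagSub P) = diagSub (MvPolynomial.pderiv (i, i) P) := by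
  rw [diagSub, derivation_aeval, Finset.sum_eq_single (i, i)]
  · simp
  · rintro ⟨a, b⟩ _ hab
    by_cases h : a = b
    · subst h
      have : a ≠ i := fun h => hab (by rw [h])
      simp [MvPolynomial.pderiv_X_of_ne this]
    · simp [h]
  · simp

theorem diagSub_pderiv_pderiv {N : ℕ} (P : MvPolynomial (Fin N × Fin N) ℂ)
    (hP : ∀ g X, ev (g * X) P = ev (X * g) P) (i j : Fin N) :
    (MvPolynomial.X j - MvPolynomial.X i) *
        diagSub (MvPolynomial.pderiv (j, i) (MvPolynomial.pderiv (i, j) P)) =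
      MvPolynomial.pderiv j (diagSub P) - MvPolynomial.pderiv i (diagSub P) := by
  have h := congrArg (fun Q => diagSub (MvPolynomial.pderiv (j, i) Q))
    (sum_X_mul_pderiv_row_eq_rOp P hP i j)
  simp only [rOp, map_sum, Derivation.leibniz, smul_eq_mul, map_add, map_mul, diagSub_X,
    Finset.sum_add_distrib] at h
  rw [Finset.sum_eq_single j, Finset.sum_eq_single i, Finset.sum_eq_single i,
    Finset.sum_eq_single j] at h
  · simp only [if_true, MvPolynomial.pderiv_X_self, map_one, mul_one] at h
    rw [pderiv_diagSub, pderiv_diagSub]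
    linear_combination h
  · intro b _ hb
    rw [MvPolynomial.pderiv_X_of_ne (by simpa using hb), map_zero, mul_zero]
  · simp
  · intro b _ hb
    rw [if_neg hb, zero_mul]
  · simp
  · intro b _ hb
    rw [MvPolynomial.pderiv_X_of_ne (by simpa using hb), map_zero, mul_zero]
  · simp
  · intro b _ hb
    rw [if_neg hb.symm, zero_mul]
  · simp

theorem diagSub_cas {N : ℕ} (P : MvPolynomial (Fin N × Fin N) ℂ) :
    diagSub (cas P) = ∑ i, ∑ j, MvPolynomial.X i * MvPolynomial.X j *
      diagSub (MvPolynomial.pderiv (j, i) (MvPolynomial.pderiv (i, j) P)) := by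
  rw [cas, Fintype.sum_prod_type, map_sum]
  refine Finset.sum_congr rfl fun i _ => ?_
  rw [map_sum]
  refine Finset.sum_congr rfl fun j _ => ?_
  rw [map_sum, Finset.sum_eq_single (j, i)]
  · simp only [map_mul, diagSub_X, if_true]
    ring
  · rintro ⟨a, b⟩ _ hab
    simp only [map_mul, diagSub_X]
    by_cases h1 : a = j
    · have : i ≠ b := by rintro rfl; exact hab (by rw [h1])
      rw [if_neg this, mul_zero, zero_mul]
    · rw [if_neg h1, zero_mul, zero_mul]
  · simp

theorem ev_sum_transl {N : ℕ} (a : UN N →₀ ℂ) (A B : UN N → Matrix (Fin N) (Fin N) ℂ)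
    (P : MvPolynomial (Fin N × Fin N) ℂ) (X : Matrix (Fin N) (Fin N) ℂ) :
    ev X (∑ U ∈ a.support, MvPolynomial.C (a U) * transl (A U) (B U) P) =
      a.sum fun U r => r * ev (A U * X * B U) P := by
  simp only [map_sum, map_mul, ev_C, ev_transl, Finsupp.sum]

theorem exists_average {N : ℕ} (μ : Measure (UN N)) [IsProbabilityMeasure μ]
    {A B : UN N → Matrix (Fin N) (Fin N) ℂ} (hA : Continuous A) (hB : Continuous B)
    (P : MvPolynomial (Fin N × Fin N) ℂ) :
    ∃ Q : MvPolynomial (Fin N × Fin N) ℂ, ∀ X, ev X Q = ∫ U, ev (A U * X * B U) P ∂μ := by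
  obtain ⟨a, ha⟩ := exists_cubature_transl μ hA hB P
  exact ⟨_, fun X => by rw [ev_sum_transl, ha X]⟩

theorem continuous_coe_UN {N : ℕ} : Continuous fun V : UN N => (V : Matrix (Fin N) (Fin N) ℂ) :=
  continuous_subtype_val

theorem continuous_star_UN {N : ℕ} :
    Continuous fun V : UN N => star (V : Matrix (Fin N) (Fin N) ℂ) :=
  continuous_subtype_val.star

/-- The average of a conjugacy class commutes with everything. -/
theorem integral_conj_swap {N : ℕ} (μ : Measure (UN N)) [μ.IsHaarMeasure] [IsProbabilityMeasure μ]
    (P : MvPolynomial (Fin N × Fin N) ℂ) (X B b : Matrix (Fin N) (Fin N) ℂ) :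
    ∫ V : UN N, ev (X * b * ((V : Matrix (Fin N) (Fin N) ℂ) * B * star (V : Matrix (Fin N) (Fin N) ℂ))) P ∂μ =
      ∫ V : UN N, ev (X * ((V : Matrix (Fin N) (Fin N) ℂ) * B * star (V : Matrix (Fin N) (Fin N) ℂ)) * b) P ∂μ := by
  have hc := continuous_coe_UN (N := N)
  have hs := continuous_star_UN (N := N)
  obtain ⟨Q₁, h₁⟩ := exists_average μ (A := fun _ => X)
    (B := fun V : UN N => (V : Matrix (Fin N) (Fin N) ℂ) * B * star (V : Matrix (Fin N) (Fin N) ℂ)) continuous_const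
    (by fun_prop) P
  obtain ⟨Q₂, h₂⟩ := exists_average μ
    (A := fun V : UN N => X * ((V : Matrix (Fin N) (Fin N) ℂ) * B * star (V : Matrix (Fin N) (Fin N) ℂ)))
    (B := fun _ => 1) (by fun_prop) continuous_const P
  have h : Q₁ - Q₂ = 0 := by
    refine eq_zero_of_unitary _ fun u hu => ?_
    rw [map_sub, h₁, h₂, sub_eq_zero]
    have hinv := integral_mul_left_eq_self (μ := μ) (fun V : UN N =>
      ev (X * ((V : Matrix (Fin N) (Fin N) ℂ) * B * star (V : Matrix (Fin N) (Fin N) ℂ)) * u * 1) P) ⟨u, hu⟩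
    rw [← hinv]
    refine integral_congr_ae (Filter.Eventually.of_forall fun V => ?_)
    have hu' : star u * u = 1 := (mem_unitaryGroup_iff').mp hu
    simp only [Submonoid.coe_mul, star_mul, mul_one, mul_assoc, hu']
  have := congrArg (ev b) (sub_eq_zero.mp h)
  rw [h₁, h₂] at this
  simpa only [mul_one] using this

structure IsSpherical {N : ℕ} (μ : Measure (UN N)) (c : Fin N → ℕ)
    (P : MvPolynomial (Fin N × Fin N) ℂ) : Prop where
  ev_eq : ∀ X, ev X P = ∫ V : UN N, ev ((V : Matrix (Fin N) (Fin N) ℂ) * X * star (V : Matrix (Fin N) (Fin N) ℂ)) (hw c) ∂μ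
  exists_sum : ∃ a : UN N →₀ ℂ, P = ∑ U ∈ a.support,
    MvPolynomial.C (a U) * transl U (star (U : Matrix (Fin N) (Fin N) ℂ)) (hw c)

theorem exists_isSpherical {N : ℕ} (μ : Measure (UN N)) [IsProbabilityMeasure μ] (c : Fin N → ℕ) :
    ∃ P, IsSpherical μ c P := by
  obtain ⟨a, ha⟩ := exists_cubature_transl μ (continuous_coe_UN (N := N)) continuous_star_UN (hw c)
  exact ⟨_, fun X => by rw [ev_sum_transl a (fun U => (U : Matrix (Fin N) (Fin N) ℂ))
    (fun U => star (U : Matrix (Fin N) (Fin N) ℂ)), ha X], a, rfl⟩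

namespace IsSpherical

variable {N : ℕ} {μ : Measure (UN N)} {c : Fin N → ℕ} {P : MvPolynomial (Fin N × Fin N) ℂ}

theorem ev_one [IsProbabilityMeasure μ] (h : IsSpherical μ c P) : ev 1 P = 1 := by
  have : ∀ V : UN N, (V : Matrix (Fin N) (Fin N) ℂ) * 1 * star (V : Matrix (Fin N) (Fin N) ℂ) = 1 :=
    fun V => by rw [mul_one]; exact mem_unitaryGroup_iff.mp V.2
  simp only [h.ev_eq, this, hw_one, integral_const, probReal_univ, one_smul]

theorem ev_conj [μ.IsHaarMeasure] [IsProbabilityMeasure μ] (h : IsSpherical μ c P) (U : UN N)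
    (X : Matrix (Fin N) (Fin N) ℂ) :
    ev ((U : Matrix (Fin N) (Fin N) ℂ) * X * star (U : Matrix (Fin N) (Fin N) ℂ)) P = ev X P := by
  rw [h.ev_eq, h.ev_eq]
  refine Eq.trans ?_ (integral_mul_right_eq_self (μ := μ) _ U)
  refine integral_congr_ae (Filter.Eventually.of_forall fun V => ?_)
  simp only [Submonoid.coe_mul, star_mul, mul_assoc]

theorem ev_mul_comm [μ.IsHaarMeasure] [IsProbabilityMeasure μ] (h : IsSpherical μ c P)
    (g X : Matrix (Fin N) (Fin N) ℂ) : ev (g * X) P = ev (X * g) P := by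
  have h0 : transl 1 X P - transl X 1 P = 0 := by
    refine eq_zero_of_unitary _ fun u hu => ?_
    have hu' : star u * u = 1 := (mem_unitaryGroup_iff').mp hu
    have := h.ev_conj (star ⟨u, hu⟩ : UN N) (u * X)
    rw [Unitary.coe_star, star_star, ← mul_assoc, hu', one_mul] at this
    rw [map_sub, ev_transl, ev_transl, sub_eq_zero, one_mul, mul_one, ← this]
  have := congrArg (ev g) (sub_eq_zero.mp h0)
  simpa only [ev_transl, one_mul, mul_one] using this

theorem cas_eq (h : IsSpherical μ c P) (l : Fin N → ℕ) (hl : ∀ i, l i = ∑ m ∈ Finset.Ici i, c m) :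
    cas P = MvPolynomial.C (∑ i : Fin N, ((l i : ℂ) * (l i - 1) - 2 * (i : ℕ) * l i)) * P := by
  obtain ⟨a, rfl⟩ := h.exists_sum
  rw [cas_sum, Finset.mul_sum]
  refine Finset.sum_congr rfl fun U _ => ?_
  rw [cas_C_mul, cas_transl, cas_hw c l hl, map_mul]
  have : ∀ r : ℂ, transl (U : Matrix (Fin N) (Fin N) ℂ) (star (U : Matrix (Fin N) (Fin N) ℂ))
      (MvPolynomial.C r) = MvPolynomial.C r := fun r => AlgHom.commutes _ r
  rw [this]
  ring

theorem integral_mul_conj [μ.IsHaarMeasure] [IsProbabilityMeasure μ] (h : IsSpherical μ c P)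
    (X B : Matrix (Fin N) (Fin N) ℂ) :
    ∫ V : UN N, ev (X * ((V : Matrix (Fin N) (Fin N) ℂ) * B * star (V : Matrix (Fin N) (Fin N) ℂ))) (hw c) ∂μ =
      ev B P * ev X (hw c) := by
  have hc := continuous_coe_UN (N := N)
  have hs := continuous_star_UN (N := N)
  obtain ⟨G, hG⟩ := exists_average μ (A := fun _ => 1)
    (B := fun V : UN N => (V : Matrix (Fin N) (Fin N) ℂ) * B * star (V : Matrix (Fin N) (Fin N) ℂ)) continuous_const
    (by fun_prop) (hw c)
  simp only [one_mul] at hG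
  have := eq_hw_of_equivariant c G (fun L X hL => ?_) (fun X b hb => ?_) X
  · rw [← hG, this, hG, h.ev_eq]
    simp only [one_mul]
  · rw [hG, hG, ← integral_const_mul]
    refine integral_congr_ae (Filter.Eventually.of_forall fun V => ?_)
    simp only
    rw [mul_assoc, hw_lower_mul c L _ hL]
  · rw [hG, hG, integral_conj_swap, ← integral_mul_const]
    refine integral_congr_ae (Filter.Eventually.of_forall fun V => ?_)
    exact hw_mul_upper c _ b hb

/-- The functional equation of zonal spherical functions. -/
theorem integral_conj_mul [μ.IsHaarMeasure] [IsProbabilityMeasure μ] (h : IsSpherical μ c P)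
    (A B : Matrix (Fin N) (Fin N) ℂ) :
    ∫ U : UN N, ev ((U : Matrix (Fin N) (Fin N) ℂ) * A * star (U : Matrix (Fin N) (Fin N) ℂ) * B) P ∂μ = ev A P * ev B P := by
  obtain ⟨a, ha⟩ := h.exists_sum
  have hev : ∀ X, ev X P = ∑ V ∈ a.support, a V *
      ev ((V : Matrix (Fin N) (Fin N) ℂ) * X * star (V : Matrix (Fin N) (Fin N) ℂ)) (hw c) := by
    intro X
    conv_lhs => rw [ha]
    simp only [map_sum, map_mul, ev_C, ev_transl]
  have hc := continuous_coe_UN (N := N)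
  have hs := continuous_star_UN (N := N)
  have hev_cont : ∀ (Q : MvPolynomial (Fin N × Fin N) ℂ), Continuous fun X => ev X Q := by
    intro Q
    simp only [ev, MvPolynomial.aeval_eq_eval]
    exact (MvPolynomial.continuous_eval Q).comp (by fun_prop)
  simp only [hev B, Finset.mul_sum]
  simp only [hev (_ * B)]
  rw [integral_finsetSum]
  · refine Finset.sum_congr rfl fun V _ => ?_
    rw [integral_const_mul, ← mul_assoc, mul_comm _ (a V), mul_assoc]
    congr 1
    rw [← h.integral_mul_conj, ← one_mul ((V : Matrix (Fin N) (Fin N) ℂ) * B * _),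
      integral_conj_swap]
    refine Eq.trans ?_ (integral_mul_left_eq_self (μ := μ) _ V)
    refine integral_congr_ae (Filter.Eventually.of_forall fun U => ?_)
    have hV : ∀ Y, star (V : Matrix (Fin N) (Fin N) ℂ) * (V * Y) = Y := fun Y => by
      rw [← mul_assoc, (mem_unitaryGroup_iff').mp V.2, one_mul]
    simp only [Submonoid.coe_mul, star_mul, mul_assoc, one_mul, hV]
  · intro V _
    have hcont : Continuous fun U : UN N => a V * ev ((V : Matrix (Fin N) (Fin N) ℂ) *
      ((U : Matrix (Fin N) (Fin N) ℂ) * A * star (U : Matrix (Fin N) (Fin N) ℂ) * B) *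
        star (V : Matrix (Fin N) (Fin N) ℂ)) (hw c) :=
      continuous_const.mul ((hev_cont _).comp (by fun_prop))
    exact integrable_UN μ ⟨_, hcont⟩

end IsSpherical

theorem exists_layers {N : ℕ} (l : Fin N → ℕ) (hl : Antitone l) :
    ∃ c : Fin N → ℕ, ∀ i, l i = ∑ m ∈ Finset.Ici i, c m := by
  let L : ℕ → ℕ := fun k => if h : k < N then l ⟨k, h⟩ else 0
  have hL : ∀ k, L (k + 1) ≤ L k := by
    intro k
    simp only [L]
    split_ifs with h1 h2
    · exact hl (by simp)
    · omega
    · exact Nat.zero_le _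
    · exact le_rfl
  refine ⟨fun m => L m - L (m + 1), fun i => ?_⟩
  have h1 : ∀ n, (i : ℕ) ≤ n → ∑ k ∈ Finset.Ico (i : ℕ) n, (L k - L (k + 1)) + L n = L i := by
    intro n hn
    induction n, hn using Nat.le_induction with
    | base => simp
    | succ n hn ih =>
      rw [Finset.sum_Ico_succ_top hn]
      have := hL n
      omega
  have h2 := h1 N i.2.le
  have h3 : L N = 0 := by simp [L]
  have h4 : L i = l i := by simp [L]
  rw [← h4, ← h2, h3, add_zero]
  symm
  refine Finset.sum_bij (fun m _ => (m : ℕ)) ?_ ?_ ?_ ?_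
  · intro m hm
    simpa using hm
  · intro a _ b _ h
    exact Fin.ext h
  · intro k hk
    rw [Finset.mem_Ico] at hk
    exact ⟨⟨k, hk.2⟩, Finset.mem_Ici.mpr (Fin.le_def.mpr hk.1), rfl⟩
  · intro m _
    rfl

theorem sum_layers_mul {N : ℕ} {R : Type*} [CommSemiring R] (l c : Fin N → ℕ)
    (hl : ∀ i, l i = ∑ m ∈ Finset.Ici i, c m) (e : Fin N → R) :
    ∑ i, (l i : R) * e i = ∑ m, (c m : R) * ∑ i ∈ Finset.Iic m, e i := by
  simp only [hl, Nat.cast_sum, Finset.sum_mul, Finset.mul_sum]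
  exact Finset.sum_comm' (by simp)

/-- The sum of the `|S|` largest values of the function with layers `c`. -/
def layerBound {N : ℕ} (c : Fin N → ℕ) (S : Finset (Fin N)) : ℕ :=
  ∑ m, c m * min S.card (m + 1)

theorem sum_Iic_eq_layerBound {N : ℕ} (l c : Fin N → ℕ)
    (hl : ∀ i, l i = ∑ m ∈ Finset.Ici i, c m) (m : Fin N) :
    ∑ i ∈ Finset.Iic m, l i = layerBound c (Finset.Iic m) := by
  have := sum_layers_mul (R := ℕ) l c hl fun i => if i ≤ m then 1 else 0
  simp only [Nat.cast_id, mul_ite, mul_one, mul_zero, ← Finset.sum_filter] at this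
  rw [layerBound]
  convert this using 2 with k
  · ext i; simp
  · rename_i k _
    have : (Finset.Iic k).filter (fun i => i ≤ m) = Finset.Iic (min k m) := by
      ext i; simp
    rw [← Finset.card_eq_sum_ones, this, Fin.card_Iic, Fin.card_Iic]
    congr 1
    rcases le_total k m with h | h
    · rw [min_eq_left h, min_eq_right (by simpa using h)]
    · rw [min_eq_right h, min_eq_left (by simpa using h)]

theorem exists_perm_of_sum_le {N : ℕ} (d c ν : Fin N → ℕ)
    (hd : ∀ i, d i = ∑ m ∈ Finset.Ici i, c m)
    (hS : ∀ S : Finset (Fin N), ∑ i ∈ S, ν i ≤ layerBound c S)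
    (hsq : ∑ i, ν i ^ 2 = ∑ i, d i ^ 2) : ∃ τ : Equiv.Perm (Fin N), ∀ i, ν (τ i) = d i := by
  let τ : Equiv.Perm (Fin N) := Tuple.sort (fun i => OrderDual.toDual (ν i))
  have hτ : Antitone (ν ∘ τ) := fun a b hab =>
    OrderDual.toDual_le_toDual.mp (Tuple.monotone_sort (fun i => OrderDual.toDual (ν i)) hab)
  obtain ⟨c', hc'⟩ := exists_layers _ hτ
  refine ⟨τ, fun i => ?_⟩
  have h1 : 0 ≤ ∑ i, ((ν ∘ τ) i : ℤ) * ((d i : ℤ) - ν (τ i)) := by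
    rw [sum_layers_mul (ν ∘ τ) c' hc']
    refine Finset.sum_nonneg fun m _ => mul_nonneg (by positivity) ?_
    rw [Finset.sum_sub_distrib, sub_nonneg]
    have h := hS ((Finset.Iic m).map τ.toEmbedding)
    rw [Finset.sum_map] at h
    have hb : layerBound c ((Finset.Iic m).map τ.toEmbedding) =
        ∑ i ∈ Finset.Iic m, d i := by
      rw [sum_Iic_eq_layerBound d c hd, layerBound, layerBound, Finset.card_map]
    rw [hb] at h
    exact_mod_cast h
  have h2 : ∑ i, ((d i : ℤ) - ν (τ i)) ^ 2 ≤ 0 := by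
    have h3 : ∑ i, (ν (τ i) : ℤ) ^ 2 = ∑ i, (d i : ℤ) ^ 2 := by
      rw [Equiv.sum_comp τ fun i => (ν i : ℤ) ^ 2]
      exact_mod_cast hsq
    have h4 : ∑ i, ((d i : ℤ) - ν (τ i)) ^ 2 = ∑ i, (d i : ℤ) ^ 2 - ∑ i, (ν (τ i) : ℤ) ^ 2 -
        2 * ∑ i, ((ν ∘ τ) i : ℤ) * ((d i : ℤ) - ν (τ i)) := by
      rw [Finset.mul_sum, ← Finset.sum_sub_distrib, ← Finset.sum_sub_distrib]
      exact Finset.sum_congr rfl fun i _ => by simp only [Function.comp]; ring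
    linarith
  have h5 := (Finset.sum_eq_zero_iff_of_nonneg fun i _ => sq_nonneg ((d i : ℤ) - ν (τ i))).mp
    (le_antisymm h2 (Finset.sum_nonneg fun i _ => sq_nonneg _)) i (Finset.mem_univ i)
  have h6 := pow_eq_zero_iff (two_ne_zero) |>.mp h5
  omega

/-- The partial sums of the exponents of `p` are at most `b`, and the degree is `b univ`. -/
def SuppBound {N : ℕ} (b : Finset (Fin N) → ℕ) (p : MvPolynomial (Fin N) ℂ) : Prop :=
  ∀ α ∈ p.support, (∀ S : Finset (Fin N), ∑ i ∈ S, α i ≤ b S) ∧ ∑ i, α i = b Finset.univ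

namespace SuppBound

variable {N : ℕ} {b b' : Finset (Fin N) → ℕ} {p q : MvPolynomial (Fin N) ℂ}

theorem one : SuppBound (fun _ => 0) (1 : MvPolynomial (Fin N) ℂ) := by
  intro α hα
  have : α = 0 := by
    by_contra h
    rw [MvPolynomial.mem_support_iff, MvPolynomial.coeff_one, if_neg (Ne.symm h)] at hα
    exact hα rfl
  simp [this]

theorem mul (hp : SuppBound b p) (hq : SuppBound b' q) :
    SuppBound (fun S => b S + b' S) (p * q) := by
  intro α hα
  obtain ⟨β, hβ, γ, hγ, rfl⟩ := Finset.mem_add.mp (MvPolynomial.support_mul p q hα)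
  simp only [Finsupp.add_apply, Finset.sum_add_distrib]
  exact ⟨fun S => add_le_add ((hp β hβ).1 S) ((hq γ hγ).1 S),
    congrArg₂ _ (hp β hβ).2 (hq γ hγ).2⟩

theorem pow (hp : SuppBound b p) (n : ℕ) : SuppBound (fun S => n * b S) (p ^ n) := by
  induction n with
  | zero => simpa using one
  | succ n ih => simpa only [pow_succ, add_mul, one_mul] using ih.mul hp

theorem prod {ι : Type*} (s : Finset ι) {b : ι → Finset (Fin N) → ℕ}
    {p : ι → MvPolynomial (Fin N) ℂ} (h : ∀ i ∈ s, SuppBound (b i) (p i)) :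
    SuppBound (fun S => ∑ i ∈ s, b i S) (∏ i ∈ s, p i) := by
  induction s using Finset.induction_on with
  | empty => simpa using one
  | insert a s ha ih =>
    simp only [Finset.sum_insert ha, Finset.prod_insert ha]
    exact (h a (Finset.mem_insert_self a s)).mul
      (ih fun i hi => h i (Finset.mem_insert_of_mem hi))

theorem sum {ι : Type*} (s : Finset ι) {p : ι → MvPolynomial (Fin N) ℂ}
    (h : ∀ i ∈ s, SuppBound b (p i)) : SuppBound b (∑ i ∈ s, p i) := by
  intro α hα
  obtain ⟨i, hi, hαi⟩ := Finset.mem_biUnion.mp (MvPolynomial.support_sum hα)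
  exact h i hi α hαi

theorem C_mul (a : ℂ) (hp : SuppBound b p) : SuppBound b (MvPolynomial.C a * p) := by
  intro α hα
  refine hp α ?_
  rw [MvPolynomial.mem_support_iff] at hα ⊢
  rw [MvPolynomial.coeff_C_mul] at hα
  exact right_ne_zero_of_mul hα

theorem X (i : Fin N) : SuppBound (fun S => if i ∈ S then 1 else 0)
    (MvPolynomial.X i : MvPolynomial (Fin N) ℂ) := by
  intro α hα
  rw [MvPolynomial.support_X, Finset.mem_singleton] at hα
  subst hα
  simp [Finsupp.single_apply]

theorem mono (hp : SuppBound b p) (h : ∀ S, b S ≤ b' S)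
    (hu : b Finset.univ = b' Finset.univ) : SuppBound b' p := fun α hα =>
  ⟨fun S => ((hp α hα).1 S).trans (h S), (hp α hα).2.trans hu⟩

theorem prod_X {ι : Type*} [Fintype ι] (f : ι → Fin N) (hf : Function.Injective f) :
    SuppBound (fun S => min S.card (Fintype.card ι)) (∏ i, MvPolynomial.X (f i)) := by
  refine (prod Finset.univ fun i _ => X (f i)).mono (fun S => ?_) ?_
  · rw [Finset.sum_boole]
    refine le_min ?_ ?_
    · exact Finset.card_le_card_of_injOn f (fun i hi => by simpa using hi) hf.injOn
    · exact Finset.card_filter_le _ _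
  · simp [Fintype.card_le_of_injective f hf |>.trans (Fintype.card_fin N).le]

end SuppBound

theorem det_mul_diagonal_mul {ι κ R : Type*} [Fintype ι] [Fintype κ] [DecidableEq ι]
    [DecidableEq κ] [CommRing R]
    (V : Matrix ι κ R) (x : κ → R) (W : Matrix κ ι R) :
    (V * diagonal x * W).det = ∑ f : ι → κ, ((∏ i, V i (f i)) * (W.submatrix f id).det) *
      ∏ i, x (f i) := by
  have h : V * diagonal x * W = fun i => ∑ k, (V i k * x k) • W k := by
    ext i j
    rw [mul_apply, Finset.sum_apply]
    simp [mul_diagonal]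
  change (detRowAlternating : (ι → R) [⋀^ι]→ₗ[R] R).toMultilinearMap (V * diagonal x * W) = _
  rw [h, MultilinearMap.map_sum]
  refine Finset.sum_congr rfl fun f _ => ?_
  rw [MultilinearMap.map_smul_univ, Finset.prod_mul_distrib]
  simp only [AlternatingMap.coe_multilinearMap, smul_eq_mul]
  change _ * (W.submatrix f id).det = _
  ring

theorem diagSub_transl_minor {N : ℕ} (V W : Matrix (Fin N) (Fin N) ℂ) (m : Fin N) :
    SuppBound (fun S => min S.card (m + 1)) (diagSub (transl V W (minor m))) := by
  have h : diagSub (transl V W (minor m)) = ∑ f : {i : Fin N // i ≤ m} → Fin N,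
      MvPolynomial.C ((∏ i : {i : Fin N // i ≤ m}, V i (f i)) * ((W.submatrix id Subtype.val).submatrix f id).det) *
        ∏ i, MvPolynomial.X (f i) := by
    refine MvPolynomial.funext fun x => ?_
    change MvPolynomial.aeval x _ = MvPolynomial.aeval x _
    rw [eval_diagSub, ev_transl, ev_minor]
    have : toSquareBlockProp (V * diagonal x * W) (fun i => i ≤ m) =
        V.submatrix (Subtype.val : {i : Fin N // i ≤ m} → Fin N) id * diagonal x *
          W.submatrix id (Subtype.val : {i : Fin N // i ≤ m} → Fin N) := by
      ext i j
      simp [toSquareBlockProp_def, mul_apply]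
    rw [this, det_mul_diagonal_mul]
    simp
  rw [h]
  refine SuppBound.sum _ fun f _ => ?_
  by_cases hf : Function.Injective f
  · refine SuppBound.C_mul _ ?_
    have := SuppBound.prod_X f hf
    have hc : Fintype.card {i : Fin N // i ≤ m} = m + 1 := by
      rw [Fintype.card_subtype, ← Fin.card_Iic m]
      congr 1
      ext i
      simp
    rwa [hc] at this
  · obtain ⟨i, j, hij, hne⟩ : ∃ i j, f i = f j ∧ i ≠ j := by
      simpa [Function.Injective] using hf
    rw [det_zero_of_row_eq hne (by ext k; simp [hij]), mul_zero, map_zero, zero_mul]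
    intro α hα
    simp at hα

theorem suppBound_diagSub_transl_hw {N : ℕ} (V W : Matrix (Fin N) (Fin N) ℂ) (c : Fin N → ℕ) :
    SuppBound (layerBound c) (diagSub (transl V W (hw c))) := by
  rw [hw, map_prod, map_prod]
  refine SuppBound.prod _ fun m _ => ?_
  rw [map_pow, map_pow]
  exact (diagSub_transl_minor V W m).pow (c m)

theorem IsSpherical.suppBound {N : ℕ} {μ : Measure (UN N)} {c : Fin N → ℕ}
    {P : MvPolynomial (Fin N × Fin N) ℂ} (h : IsSpherical μ c P) :
    SuppBound (layerBound c) (diagSub P) := by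
  obtain ⟨a, rfl⟩ := h.exists_sum
  rw [map_sum]
  refine SuppBound.sum _ fun U _ => ?_
  rw [map_mul]
  have : diagSub (MvPolynomial.C (a U) : MvPolynomial (Fin N × Fin N) ℂ) =
    MvPolynomial.C (a U) := AlgHom.commutes _ _
  rw [this]
  exact (suppBound_diagSub_transl_hw _ _ c).C_mul _

theorem coeff_X_mul_pderiv {σ : Type*} (i : σ) (p : MvPolynomial σ ℂ) (ν : σ →₀ ℕ) :
    MvPolynomial.coeff ν (MvPolynomial.X i * MvPolynomial.pderiv i p) =
      ν i * MvPolynomial.coeff ν p := by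
  induction p using MvPolynomial.induction_on' with
  | monomial u a =>
    rw [MvPolynomial.X_mul_pderiv_monomial, MvPolynomial.coeff_smul, MvPolynomial.coeff_monomial]
    split_ifs with h
    · rw [h, nsmul_eq_mul]
    · simp
  | add p q hp hq => rw [map_add, mul_add, MvPolynomial.coeff_add, hp, hq, MvPolynomial.coeff_add,
      mul_add]

theorem coeff_X_mul_X_mul_pderiv_pderiv {σ : Type*} (i : σ) (p : MvPolynomial σ ℂ) (ν : σ →₀ ℕ) :
    MvPolynomial.coeff ν (MvPolynomial.X i * MvPolynomial.X i *
      MvPolynomial.pderiv i (MvPolynomial.pderiv i p)) =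
      ν i * (ν i - 1) * MvPolynomial.coeff ν p := by
  have h : MvPolynomial.X i * MvPolynomial.X i *
      MvPolynomial.pderiv i (MvPolynomial.pderiv i p) =
      MvPolynomial.X i * MvPolynomial.pderiv i (MvPolynomial.X i * MvPolynomial.pderiv i p) -
        MvPolynomial.X i * MvPolynomial.pderiv i p := by
    simp only [Derivation.leibniz, smul_eq_mul, MvPolynomial.pderiv_X_self]
    ring
  rw [h, MvPolynomial.coeff_sub, coeff_X_mul_pderiv, coeff_X_mul_pderiv]
  ring

/-- The operator `∑ xᵢ² ∂ᵢ²`. -/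
def eulerSq {N : ℕ} (p : MvPolynomial (Fin N) ℂ) : MvPolynomial (Fin N) ℂ :=
  ∑ i, MvPolynomial.X i * MvPolynomial.X i * MvPolynomial.pderiv i (MvPolynomial.pderiv i p)

theorem coeff_eulerSq {N : ℕ} (p : MvPolynomial (Fin N) ℂ) (ν : Fin N →₀ ℕ) :
    MvPolynomial.coeff ν (eulerSq p) = (∑ i, (ν i : ℂ) * (ν i - 1)) * MvPolynomial.coeff ν p := by
  simp only [eulerSq, MvPolynomial.coeff_sum, coeff_X_mul_X_mul_pderiv_pderiv, Finset.sum_mul]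

theorem eulerSq_eq {N : ℕ} (p : MvPolynomial (Fin N) ℂ) (r : ℂ)
    (h : ∀ ν ∈ p.support, ∑ i, (ν i : ℂ) * (ν i - 1) = r) :
    eulerSq p = MvPolynomial.C r * p := by
  ext ν
  rw [coeff_eulerSq, MvPolynomial.coeff_C_mul]
  by_cases hν : ν ∈ p.support
  · rw [h ν hν]
  · rw [MvPolynomial.notMem_support_iff.mp hν, mul_zero, mul_zero]

theorem sum_X_mul_pderiv_eq {N : ℕ} (p : MvPolynomial (Fin N) ℂ) (n : ℕ)
    (h : ∀ ν ∈ p.support, ∑ i, ν i = n) :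
    ∑ i, MvPolynomial.X i * MvPolynomial.pderiv i p = MvPolynomial.C (n : ℂ) * p := by
  ext ν
  rw [MvPolynomial.coeff_sum, MvPolynomial.coeff_C_mul]
  simp only [coeff_X_mul_pderiv, ← Finset.sum_mul]
  by_cases hν : ν ∈ p.support
  · rw [← h ν hν, Nat.cast_sum]
  · rw [MvPolynomial.notMem_support_iff.mp hν, mul_zero, mul_zero]

/-- The generic Vandermonde determinant. -/
def van (N : ℕ) : MvPolynomial (Fin N) ℂ := (vandermonde MvPolynomial.X).det

theorem exists_perm_of_mem_support_van {N : ℕ} (α : Fin N →₀ ℕ) (hα : α ∈ (van N).support) :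
    ∃ σ : Equiv.Perm (Fin N), ∀ i, α (σ i) = i := by
  rw [van, det_apply] at hα
  obtain ⟨σ, -, hσ⟩ := Finset.mem_biUnion.mp (MvPolynomial.support_sum hα)
  refine ⟨σ, fun i => ?_⟩
  have h : ∏ i, vandermonde (MvPolynomial.X : Fin N → MvPolynomial (Fin N) ℂ) (σ i) i =
      MvPolynomial.monomial (∑ i, Finsupp.single (σ i) (i : ℕ)) 1 := by
    rw [MvPolynomial.monomial_sum_one]
    exact Finset.prod_congr rfl fun i _ => by
      rw [vandermonde_apply, MvPolynomial.X_pow_eq_monomial]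
  have h2 : α ∈ (MvPolynomial.monomial (∑ i, Finsupp.single (σ i) (i : ℕ)) (1 : ℂ)).support := by
    rw [MvPolynomial.mem_support_iff] at hσ ⊢
    rw [h, MvPolynomial.coeff_smul] at hσ
    exact fun h0 => hσ (by rw [h0, smul_zero])
  have h3 := MvPolynomial.support_monomial_subset h2
  rw [Finset.mem_singleton] at h3
  rw [h3, Finsupp.finsetSum_apply, Finset.sum_eq_single i]
  · simp
  · intro b _ hb
    simp [hb]
  · simp

theorem aeval_van {N : ℕ} (x : Fin N → ℂ) : MvPolynomial.aeval x (van N) = (vandermonde x).det := by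
  rw [van, AlgHom.map_det]
  congr 1
  ext i j
  simp [vandermonde_apply]

theorem van_ne_zero (N : ℕ) : van N ≠ 0 :=
  det_vandermonde_ne_zero_iff.mpr (MvPolynomial.X_injective)

theorem aeval_derivation_prod {σ ι : Type*} (D : Derivation ℂ (MvPolynomial σ ℂ) (MvPolynomial σ ℂ))
    (x : σ → ℂ) (s : Finset ι) (f : ι → MvPolynomial σ ℂ)
    (h : ∀ k ∈ s, MvPolynomial.aeval x (f k) ≠ 0) :
    MvPolynomial.aeval x (D (∏ k ∈ s, f k)) = MvPolynomial.aeval x (∏ k ∈ s, f k) *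
      ∑ k ∈ s, MvPolynomial.aeval x (D (f k)) / MvPolynomial.aeval x (f k) := by
  induction s using Finset.induction_on with
  | empty => simp
  | insert a s ha ih =>
    have h1 := h a (Finset.mem_insert_self a s)
    rw [Finset.prod_insert ha, Finset.sum_insert ha, Derivation.leibniz, map_add, smul_eq_mul,
      smul_eq_mul, map_mul, map_mul, ih fun k hk => h k (Finset.mem_insert_of_mem hk), map_mul]
    field_simp
    ring

theorem aeval_pderiv_van {N : ℕ} (x : Fin N → ℂ) (hx : Function.Injective x) (i : Fin N) :
    MvPolynomial.aeval x (MvPolynomial.pderiv i (van N)) =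
      MvPolynomial.aeval x (van N) * ∑ j ∈ Finset.univ.erase i, (x i - x j)⁻¹ := by
  have hprod : van N = ∏ p ∈ Finset.univ.filter (fun p : Fin N × Fin N => p.1 < p.2),
      (MvPolynomial.X p.2 - MvPolynomial.X p.1) := by
    rw [van, det_vandermonde, Finset.prod_sigma']
    refine Finset.prod_bij (fun p _ => (p.1, p.2)) ?_ ?_ ?_ ?_
    · simp
    · rintro ⟨a, b⟩ _ ⟨c, d⟩ _ h
      simpa using h
    · rintro ⟨a, b⟩ h
      exact ⟨⟨a, b⟩, by simpa using h, rfl⟩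
    · simp
  rw [hprod, aeval_derivation_prod]
  · congr 1
    have h : ∀ p : Fin N × Fin N, MvPolynomial.aeval x (MvPolynomial.pderiv i
        (MvPolynomial.X p.2 - MvPolynomial.X p.1 : MvPolynomial (Fin N) ℂ)) /
        MvPolynomial.aeval x (MvPolynomial.X p.2 - MvPolynomial.X p.1 : MvPolynomial (Fin N) ℂ) =
        (if p.2 = i then (x i - x p.1)⁻¹ else 0) + if p.1 = i then (x i - x p.2)⁻¹ else 0 := by
      rintro ⟨a, b⟩
      have h2 : (x b - x i)⁻¹ = - (x i - x b)⁻¹ := by rw [← neg_sub, inv_neg]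
      simp only [map_sub, MvPolynomial.aeval_X, MvPolynomial.pderiv_X, Pi.single_apply, div_eq_mul_inv]
      by_cases ha : a = i <;> by_cases hb : b = i
      · subst ha; subst hb; simp
      · subst ha; simp [hb, h2]
      · subst hb; simp [ha]
      · simp [ha, hb]
    rw [Finset.sum_congr rfl fun p _ => h p, Finset.sum_filter, Fintype.sum_prod_type]
    have h3 : ∀ a b : Fin N, (if a < b then ((if b = i then (x i - x a)⁻¹ else 0) +
        if a = i then (x i - x b)⁻¹ else 0) else 0) =
        (if b = i then (if a < i then (x i - x a)⁻¹ else 0) else 0) +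
        if a = i then (if i < b then (x i - x b)⁻¹ else 0) else 0 := by
      intro a b
      by_cases ha : a = i <;> by_cases hb : b = i
      · subst ha; subst hb; simp
      · subst ha; simp [hb]
      · subst hb; simp [ha]
      · simp [ha, hb]
    simp only [h3, Finset.sum_add_distrib]
    rw [Finset.sum_comm (f := fun a b => if a = i then (if i < b then (x i - x b)⁻¹ else 0) else 0)]
    simp only [Finset.sum_ite_eq', Finset.mem_univ, if_true]
    rw [← Finset.sum_add_distrib, ← Finset.sum_erase Finset.univ (a := i)]
    · refine Finset.sum_congr rfl fun j hj => ?_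
      rcases lt_or_gt_of_ne (Finset.ne_of_mem_erase hj) with h | h
      · simp [h, h.not_gt]
      · simp [h, h.not_gt]
    · simp
  · intro p hp
    rw [map_sub, MvPolynomial.aeval_X, MvPolynomial.aeval_X, sub_ne_zero]
    exact fun h => (Finset.mem_filter.mp hp).2.ne' (hx h)

theorem eq_of_aeval_injective {N : ℕ} {p q : MvPolynomial (Fin N) ℂ}
    (h : ∀ x : Fin N → ℂ, Function.Injective x → MvPolynomial.aeval x p = MvPolynomial.aeval x q) :
    p = q := by
  refine mul_left_cancel₀ (van_ne_zero N) (MvPolynomial.funext fun x => ?_)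
  change MvPolynomial.aeval x _ = MvPolynomial.aeval x _
  rw [map_mul, map_mul]
  by_cases hx : Function.Injective x
  · rw [h x hx]
  · rw [aeval_van, not_ne_iff.mp (mt det_vandermonde_ne_zero_iff.mp hx), zero_mul, zero_mul]

theorem sum_sum_erase_comm {N : ℕ} (f : Fin N → Fin N → ℂ) :
    ∑ i, ∑ j ∈ Finset.univ.erase i, f i j = ∑ i, ∑ j ∈ Finset.univ.erase i, f j i :=
  Finset.sum_comm' (by simp [eq_comm])

/-- The radial part of the Casimir operator. -/
theorem eulerSq_van_mul {N : ℕ} (P : MvPolynomial (Fin N × Fin N) ℂ)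
    (hP : ∀ g X, ev (g * X) P = ev (X * g) P) (κ n r : ℂ) (hcas : cas P = MvPolynomial.C κ * P)
    (hn : ∑ i, MvPolynomial.X i * MvPolynomial.pderiv i (diagSub P) =
      MvPolynomial.C n * diagSub P)
    (hr : eulerSq (van N) = MvPolynomial.C r * van N) :
    eulerSq (van N * diagSub P) =
      MvPolynomial.C (κ + 2 * (N - 1) * n + r) * (van N * diagSub P) := by
  refine eq_of_aeval_injective fun x hx => ?_
  have hC : ∀ (a : ℂ), MvPolynomial.aeval x (MvPolynomial.C a : MvPolynomial (Fin N) ℂ) = a :=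
    fun a => by simp
  have hdC : diagSub (MvPolynomial.C κ : MvPolynomial (Fin N × Fin N) ℂ) = MvPolynomial.C κ :=
    AlgHom.commutes _ _
  have hcas := congrArg (fun Q => MvPolynomial.aeval x (diagSub Q)) hcas
  have hn := congrArg (MvPolynomial.aeval x) hn
  have hr := congrArg (MvPolynomial.aeval x) hr
  have hD := fun i j => congrArg (MvPolynomial.aeval x) (diagSub_pderiv_pderiv P hP i j)
  simp only [diagSub_cas, map_sum, map_mul, hdC, hC, MvPolynomial.aeval_X, map_sub, eulerSq]
    at hcas hn hr hD
  have hsplit : ∀ i, ∑ j, x i * x j * MvPolynomial.aeval x (diagSub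
      (MvPolynomial.pderiv (j, i) (MvPolynomial.pderiv (i, j) P))) =
      x i * x i * MvPolynomial.aeval x (MvPolynomial.pderiv i (MvPolynomial.pderiv i (diagSub P))) +
      ∑ j ∈ Finset.univ.erase i, x i * x j * MvPolynomial.aeval x (diagSub
        (MvPolynomial.pderiv (j, i) (MvPolynomial.pderiv (i, j) P))) := by
    intro i
    rw [← Finset.add_sum_erase _ _ (Finset.mem_univ i), pderiv_diagSub, pderiv_diagSub]
  simp only [hsplit, Finset.sum_add_distrib] at hcas
  set p := diagSub P with hp
  have hcross : ∑ i, x i * x i * (∑ j ∈ Finset.univ.erase i, (x i - x j)⁻¹) *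
        MvPolynomial.aeval x (MvPolynomial.pderiv i p) * 2 =
      ∑ i, ∑ j ∈ Finset.univ.erase i, x i * x j * MvPolynomial.aeval x (diagSub
        (MvPolynomial.pderiv (j, i) (MvPolynomial.pderiv (i, j) P))) +
      2 * (N - 1) * (n * MvPolynomial.aeval x p) := by
    have h1 : ∀ i, x i * x i * (∑ j ∈ Finset.univ.erase i, (x i - x j)⁻¹) *
        MvPolynomial.aeval x (MvPolynomial.pderiv i p) = ∑ j ∈ Finset.univ.erase i,
          x i * x i * (x i - x j)⁻¹ * MvPolynomial.aeval x (MvPolynomial.pderiv i p) := by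
      intro i
      rw [Finset.mul_sum, Finset.sum_mul]
    have h2 : ∑ i, ∑ j ∈ Finset.univ.erase i,
        (x i * MvPolynomial.aeval x (MvPolynomial.pderiv i p) +
          x j * MvPolynomial.aeval x (MvPolynomial.pderiv j p)) =
        2 * (N - 1) * (n * MvPolynomial.aeval x p) := by
      simp only [Finset.sum_add_distrib]
      rw [sum_sum_erase_comm (fun i j => x j * MvPolynomial.aeval x (MvPolynomial.pderiv j p))]
      simp only [Finset.sum_const, Finset.card_erase_of_mem (Finset.mem_univ _), Finset.card_univ,
        Fintype.card_fin, nsmul_eq_mul, ← Finset.mul_sum, hn]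
      rcases Nat.eq_zero_or_pos N with h0 | h0
      · subst h0
        simp only [Finset.univ_eq_empty, Finset.sum_empty] at hn
        rw [← hn]; simp
      · rw [Nat.cast_sub h0]
        push_cast
        ring
    simp only [mul_two, h1]
    rw [Finset.sum_add_distrib]
    nth_rewrite 2 [sum_sum_erase_comm]
    rw [← h2, ← Finset.sum_add_distrib, ← Finset.sum_add_distrib]
    refine Finset.sum_congr rfl fun i _ => ?_
    rw [← Finset.sum_add_distrib, ← Finset.sum_add_distrib]
    refine Finset.sum_congr rfl fun j hj => ?_
    have hij : x i - x j ≠ 0 := sub_ne_zero.mpr fun h => Finset.ne_of_mem_erase hj (hx h).symm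
    have hinv : (x j - x i)⁻¹ = - (x i - x j)⁻¹ := by rw [← neg_sub, inv_neg]
    rw [hinv]
    have := hD i j
    field_simp
    linear_combination (x i * x j) * this
  have hexp : ∀ i, MvPolynomial.aeval x (MvPolynomial.pderiv i (MvPolynomial.pderiv i
      (van N * p))) =
      MvPolynomial.aeval x (MvPolynomial.pderiv i (MvPolynomial.pderiv i (van N))) *
        MvPolynomial.aeval x p +
      2 * (MvPolynomial.aeval x (van N) * (∑ j ∈ Finset.univ.erase i, (x i - x j)⁻¹)) *
        MvPolynomial.aeval x (MvPolynomial.pderiv i p) +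
      MvPolynomial.aeval x (van N) *
        MvPolynomial.aeval x (MvPolynomial.pderiv i (MvPolynomial.pderiv i p)) := by
    intro i
    rw [← aeval_pderiv_van x hx i]
    simp only [Derivation.leibniz, smul_eq_mul, map_add, map_mul]
    ring
  simp only [eulerSq, map_sum, map_mul, MvPolynomial.aeval_X, hexp, hC]
  have : ∀ i, x i * x i * (MvPolynomial.aeval x (MvPolynomial.pderiv i (MvPolynomial.pderiv i
        (van N))) * MvPolynomial.aeval x p +
      2 * (MvPolynomial.aeval x (van N) * (∑ j ∈ Finset.univ.erase i, (x i - x j)⁻¹)) *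
        MvPolynomial.aeval x (MvPolynomial.pderiv i p) +
      MvPolynomial.aeval x (van N) *
        MvPolynomial.aeval x (MvPolynomial.pderiv i (MvPolynomial.pderiv i p))) =
      (x i * x i * MvPolynomial.aeval x (MvPolynomial.pderiv i (MvPolynomial.pderiv i
        (van N)))) * MvPolynomial.aeval x p +
      MvPolynomial.aeval x (van N) * (x i * x i * (∑ j ∈ Finset.univ.erase i, (x i - x j)⁻¹) *
        MvPolynomial.aeval x (MvPolynomial.pderiv i p) * 2) +
      MvPolynomial.aeval x (van N) * (x i * x i *
        MvPolynomial.aeval x (MvPolynomial.pderiv i (MvPolynomial.pderiv i p))) := by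
    intro i; ring
  simp only [this, Finset.sum_add_distrib, ← Finset.mul_sum, ← Finset.sum_mul, hr]
  rw [Finset.sum_mul, hcross]
  linear_combination MvPolynomial.aeval x (van N) * hcas

theorem sum_eq_sum_layers {N : ℕ} (l c : Fin N → ℕ) (hl : ∀ i, l i = ∑ m ∈ Finset.Ici i, c m)
    (S : Finset (Fin N)) : ∑ i ∈ S, l i = ∑ m, c m * (S ∩ Finset.Iic m).card := by
  have := sum_layers_mul (R := ℕ) l c hl fun i => if i ∈ S then 1 else 0
  simp only [Nat.cast_id, mul_ite, mul_one, mul_zero, Finset.sum_boole] at this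
  rw [← Finset.sum_filter, Finset.filter_univ_mem] at this
  rw [this]
  refine Finset.sum_congr rfl fun m _ => ?_
  rw [Finset.filter_mem_eq_inter, Finset.inter_comm]

theorem sum_le_layerBound {N : ℕ} (l c : Fin N → ℕ) (hl : ∀ i, l i = ∑ m ∈ Finset.Ici i, c m)
    (S : Finset (Fin N)) : ∑ i ∈ S, l i ≤ layerBound c S := by
  rw [sum_eq_sum_layers l c hl]
  refine Finset.sum_le_sum fun m _ => Nat.mul_le_mul_left _ (le_min ?_ ?_)
  · exact Finset.card_le_card Finset.inter_subset_left
  · rw [← Fin.card_Iic]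
    exact Finset.card_le_card Finset.inter_subset_right

theorem sum_univ_eq_layerBound {N : ℕ} (l c : Fin N → ℕ)
    (hl : ∀ i, l i = ∑ m ∈ Finset.Ici i, c m) : ∑ i, l i = layerBound c Finset.univ := by
  rw [sum_eq_sum_layers l c hl]
  refine Finset.sum_congr rfl fun m _ => ?_
  rw [Finset.univ_inter, Fin.card_Iic, Finset.card_univ, Fintype.card_fin, min_eq_right m.2]

theorem suppBound_van {N : ℕ} (c : Fin N → ℕ)
    (hc : ∀ i : Fin N, (i.rev : ℕ) = ∑ m ∈ Finset.Ici i, c m) :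
    SuppBound (layerBound c) (van N) := by
  intro α hα
  obtain ⟨σ, hσ⟩ := exists_perm_of_mem_support_van α hα
  let τ : Equiv.Perm (Fin N) := σ.symm.trans Fin.revPerm
  have hτ : ∀ i, α i = ((τ i).rev : ℕ) := by
    intro i
    simp only [τ, Equiv.trans_apply, Fin.revPerm_apply, Fin.rev_rev]
    rw [← hσ, Equiv.apply_symm_apply]
  constructor
  · intro S
    have := sum_le_layerBound (fun i => (i.rev : ℕ)) c hc (S.map τ.toEmbedding)
    rw [Finset.sum_map, layerBound, Finset.card_map] at this
    rw [Finset.sum_congr rfl fun i _ => hτ i]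
    exact this
  · simp only [hτ]
    rw [Equiv.sum_comp τ fun i => (i.rev : ℕ), sum_univ_eq_layerBound _ c hc]

theorem eulerSq_van (N : ℕ) :
    eulerSq (van N) = MvPolynomial.C (∑ i : Fin N, ((i : ℕ) : ℂ) * ((i : ℕ) - 1)) * van N := by
  refine eulerSq_eq _ _ fun α hα => ?_
  obtain ⟨σ, hσ⟩ := exists_perm_of_mem_support_van α hα
  rw [← Equiv.sum_comp σ]
  simp only [hσ]

/-- The monomials in the numerator of the Weyl character formula are permutations of `λ + ρ`. -/
theorem IsSpherical.exists_perm {N : ℕ} {μ : Measure (UN N)} [μ.IsHaarMeasure]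
    [IsProbabilityMeasure μ] {c l : Fin N → ℕ}
    (hl : ∀ i, l i = ∑ m ∈ Finset.Ici i, c m) {P : MvPolynomial (Fin N × Fin N) ℂ}
    (h : IsSpherical μ c P) {ν : Fin N →₀ ℕ} (hν : ν ∈ (van N * diagSub P).support) :
    ∃ τ : Equiv.Perm (Fin N), ∀ i, ν (τ i) = l i + i.rev := by
  obtain ⟨e, he⟩ := exists_layers (fun i : Fin N => (i.rev : ℕ))
    fun i j hij => Fin.rev_le_rev.mpr hij
  have hd : ∀ i : Fin N, l i + i.rev = ∑ m ∈ Finset.Ici i, (c + e) m := fun i => by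
    simp only [Pi.add_apply, Finset.sum_add_distrib, ← hl, ← he]
  have hb : ∀ S, layerBound e S + layerBound c S = layerBound (c + e) S := fun S => by
    simp only [layerBound, Pi.add_apply, add_mul, Finset.sum_add_distrib, add_comm]
  obtain ⟨hS, hu⟩ := (suppBound_van e he).mul h.suppBound ν hν
  simp only [hb] at hS hu
  rw [← sum_univ_eq_layerBound _ _ hd] at hu
  have hn := sum_X_mul_pderiv_eq (diagSub P) (∑ i, l i) fun α hα => by
    rw [(h.suppBound α hα).2, sum_univ_eq_layerBound l c hl]
  have hE := congrArg (MvPolynomial.coeff ν) (eulerSq_van_mul P h.ev_mul_comm _ _ _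
    (h.cas_eq l hl) hn (eulerSq_van N))
  rw [coeff_eulerSq, MvPolynomial.coeff_C_mul] at hE
  have hE := mul_right_cancel₀ (MvPolynomial.mem_support_iff.mp hν) hE
  refine exists_perm_of_sum_le (fun i => l i + i.rev) (c + e) ν hd hS ?_
  have hu' : ∑ i, (ν i : ℂ) = ∑ i, ((l i : ℂ) + (i.rev : ℕ)) := by exact_mod_cast hu
  have hrev : ∑ i : Fin N, ((i : ℕ) : ℂ) * ((i : ℕ) - 1) =
      ∑ i : Fin N, ((i.rev : ℕ) : ℂ) * ((i.rev : ℕ) - 1) :=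
    (Equiv.sum_comp Fin.revPerm fun i : Fin N => ((i : ℕ) : ℂ) * ((i : ℕ) - 1)).symm
  have hN : ∀ i : Fin N, ((i.rev : ℕ) : ℂ) = N - 1 - (i : ℕ) := fun i => by
    have : (i.rev : ℕ) + 1 + i = N := by rw [Fin.val_rev]; omega
    have : ((i.rev : ℕ) : ℂ) + 1 + (i : ℕ) = N := by exact_mod_cast this
    linear_combination this
  have : ∑ i, (ν i : ℂ) ^ 2 = ∑ i, ((l i : ℂ) + (i.rev : ℕ)) ^ 2 := by
    have h1 : ∑ i, (ν i : ℂ) ^ 2 = ∑ i, (ν i : ℂ) * (ν i - 1) + ∑ i, (ν i : ℂ) := by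
      rw [← Finset.sum_add_distrib]
      exact Finset.sum_congr rfl fun i _ => by ring
    rw [h1, hE, hu', hrev]
    push_cast
    rw [Finset.mul_sum, ← Finset.sum_add_distrib, ← Finset.sum_add_distrib,
      ← Finset.sum_add_distrib]
    refine Finset.sum_congr rfl fun i _ => ?_
    rw [hN]
    ring
  exact_mod_cast this

theorem aeval_comp_perm_diagSub {N : ℕ} (P : MvPolynomial (Fin N × Fin N) ℂ)
    (hP : ∀ g X, ev (g * X) P = ev (X * g) P) (σ : Equiv.Perm (Fin N)) (x : Fin N → ℂ) :
    MvPolynomial.aeval (x ∘ σ) (diagSub P) = MvPolynomial.aeval x (diagSub P) := by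
  rw [eval_diagSub, eval_diagSub]
  have h1 : diagonal (x ∘ σ) = (1 : Matrix (Fin N) (Fin N) ℂ).submatrix σ id *
      (diagonal x * (1 : Matrix (Fin N) (Fin N) ℂ).submatrix id σ) := by
    rw [← submatrix_diagonal_equiv]
    ext i j
    suffices (if i = j then x (σ i) else 0) = if i = j then x (σ j) else 0 by
      simpa [mul_apply, one_apply, diagonal_apply] using this
    split_ifs with h
    exacts [by rw [h], rfl]
  have h2 : (1 : Matrix (Fin N) (Fin N) ℂ).submatrix id σ *
      (1 : Matrix (Fin N) (Fin N) ℂ).submatrix σ id = 1 := by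
    rw [submatrix_mul_equiv, mul_one, submatrix_id_id]
  rw [h1, hP, Matrix.mul_assoc, h2, mul_one]

theorem aeval_comp_perm_van {N : ℕ} (σ : Equiv.Perm (Fin N)) (x : Fin N → ℂ) :
    MvPolynomial.aeval (x ∘ σ) (van N) =
      (Equiv.Perm.sign σ : ℂ) * MvPolynomial.aeval x (van N) := by
  rw [aeval_van, aeval_van, ← det_permute]
  rfl

/-- An alternating polynomial whose exponents are permutations of `d` is a multiple of the
alternant of `d`. -/
theorem exists_aeval_eq_alternant {N : ℕ} (g : MvPolynomial (Fin N) ℂ) (d : Fin N → ℕ)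
    (halt : ∀ (σ : Equiv.Perm (Fin N)) (x : Fin N → ℂ), MvPolynomial.aeval (x ∘ σ) g =
      (Equiv.Perm.sign σ : ℂ) * MvPolynomial.aeval x g)
    (hd : ∀ ν ∈ g.support, ∃ τ : Equiv.Perm (Fin N), ∀ i, ν (τ i) = d i) :
    ∃ k : ℂ, ∀ x : Fin N → ℂ,
      MvPolynomial.aeval x g = k * (Matrix.of fun i j => x i ^ d j).det := by
  have hν : ∀ ν ∈ g.support, ∃ k : ℂ, ∀ x : Fin N → ℂ,
      (Matrix.of fun i j => x i ^ ν j).det = k * (Matrix.of fun i j => x i ^ d j).det := by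
    intro ν h
    obtain ⟨τ, hτ⟩ := hd ν h
    refine ⟨(Equiv.Perm.sign τ : ℂ), fun x => ?_⟩
    have : (Matrix.of fun i j => x i ^ d j) =
        (Matrix.of fun i j => x i ^ ν j).submatrix id τ := by
      ext i j
      simp [hτ]
    rw [this, det_permute', ← mul_assoc, ← Int.cast_mul, ← Units.val_mul, Int.units_mul_self]
    simp
  choose! k hk using hν
  refine ⟨((N.factorial : ℂ))⁻¹ * ∑ ν ∈ g.support, MvPolynomial.coeff ν g * k ν, fun x => ?_⟩
  have h1 : (N.factorial : ℂ) * MvPolynomial.aeval x g =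
      ∑ σ : Equiv.Perm (Fin N), (Equiv.Perm.sign σ : ℂ) * MvPolynomial.aeval (x ∘ σ) g := by
    simp only [halt, ← mul_assoc, ← Int.cast_mul, ← Units.val_mul, Int.units_mul_self]
    simp [Fintype.card_perm]
  have h2 : ∑ σ : Equiv.Perm (Fin N), (Equiv.Perm.sign σ : ℂ) * MvPolynomial.aeval (x ∘ σ) g =
      ∑ ν ∈ g.support, MvPolynomial.coeff ν g * (Matrix.of fun i j => x i ^ ν j).det := by
    simp only [MvPolynomial.aeval_eq_eval, MvPolynomial.eval_eq', Finset.mul_sum, det_apply']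
    rw [Finset.sum_comm]
    refine Finset.sum_congr rfl fun ν _ => Finset.sum_congr rfl fun σ _ => ?_
    simp only [Function.comp, of_apply]
    ring
  have h3 : MvPolynomial.aeval x g = (N.factorial : ℂ)⁻¹ * ((N.factorial : ℂ) *
      MvPolynomial.aeval x g) := by
    rw [inv_mul_cancel_left₀ (by exact_mod_cast N.factorial_ne_zero)]
  rw [h3, h1, h2, mul_assoc, Finset.sum_mul]
  congr 1
  exact Finset.sum_congr rfl fun ν h => by rw [hk ν h, mul_assoc]

theorem IsSpherical.exists_van_mul_eq {N : ℕ} {μ : Measure (UN N)} [μ.IsHaarMeasure]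
    [IsProbabilityMeasure μ] {c l : Fin N → ℕ}
    (hl : ∀ i, l i = ∑ m ∈ Finset.Ici i, c m) {P : MvPolynomial (Fin N × Fin N) ℂ}
    (h : IsSpherical μ c P) : ∃ k : ℂ, ∀ x : Fin N → ℂ,
      (vandermonde x).det * ev (diagonal x) P =
        k * (Matrix.of fun i j => x i ^ (l j + j.rev : ℕ)).det := by
  obtain ⟨k, hk⟩ := exists_aeval_eq_alternant (van N * diagSub P) (fun j => l j + j.rev)
    (fun σ x => by
      rw [map_mul, map_mul, aeval_comp_perm_van, aeval_comp_perm_diagSub P h.ev_mul_comm,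
        mul_assoc])
    fun ν hν => h.exists_perm hl hν
  refine ⟨k, fun x => ?_⟩
  rw [← hk, map_mul, aeval_van, eval_diagSub]

section JacobiTrudi

open PowerSeries

theorem mk_pow_mul_one_sub {K : Type*} [CommRing K] (a : K) :
    (mk fun m => a ^ m) * (1 - C a * X) = 1 := by
  ext m
  rw [mul_sub, mul_one, mul_left_comm, map_sub, coeff_C_mul, coeff_mk, coeff_one]
  cases m with
  | zero => simp
  | succ m => rw [coeff_succ_mul_X, coeff_mk, if_neg m.succ_ne_zero, pow_succ', sub_self]

theorem derivative_prod_one_sub {K ι : Type*} [CommRing K] (x : ι → K) (s : Finset ι) :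
    derivative K (∏ i ∈ s, (1 - C (x i) * X)) =
      - ((∑ i ∈ s, mk fun m => x i ^ (m + 1)) * ∏ i ∈ s, (1 - C (x i) * X)) := by
  induction s using Finset.induction_on with
  | empty => simp
  | insert a s ha ih =>
    have h : (mk fun m => x a ^ (m + 1)) * (1 - C (x a) * X) = C (x a) := by
      have : (mk fun m => x a ^ (m + 1)) = C (x a) * mk fun m => x a ^ m := by
        ext m
        rw [coeff_C_mul, coeff_mk, coeff_mk, pow_succ']
      rw [this, mul_assoc, mk_pow_mul_one_sub, mul_one]
    have hd : derivative K (1 - C (x a) * X) = - C (x a) := by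
      simp [map_sub, Derivation.leibniz, smul_eq_mul]
    rw [Finset.prod_insert ha, Finset.sum_insert ha, Derivation.leibniz, ih, hd]
    simp only [smul_eq_mul]
    linear_combination (∏ i ∈ s, (1 - C (x i) * X)) * h

theorem coeff_prod_one_sub_eq_zero {K ι : Type*} [CommRing K] (x : ι → K) (s : Finset ι) (b : ℕ)
    (hb : s.card < b) : coeff b (∏ i ∈ s, (1 - C (x i) * X)) = 0 := by
  induction s using Finset.induction_on generalizing b with
  | empty =>
    rw [Finset.prod_empty, coeff_one, if_neg]
    rintro rfl
    simp at hb
  | insert a s ha ih =>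
    rw [Finset.card_insert_of_notMem ha] at hb
    obtain ⟨b, rfl⟩ : ∃ b', b = b' + 1 := ⟨b - 1, by omega⟩
    rw [Finset.prod_insert ha, sub_mul, one_mul, map_sub, mul_assoc, coeff_C_mul,
      coeff_succ_X_mul, ih _ (by omega), ih _ (by omega), mul_zero, sub_zero]

theorem hMat_succ {N : ℕ} (X : Matrix (Fin N) (Fin N) ℂ) (k : ℕ) :
    ((k : ℂ) + 1) * hMat X (k + 1) =
      ∑ m ∈ Finset.range (k + 1), (X ^ (m + 1)).trace * hMat X (k - m) := by
  rw [hMat, mul_inv_cancel_left₀ (Nat.cast_add_one_ne_zero k)]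

theorem derivative_mk_hMat {N : ℕ} (x : Fin N → ℂ) :
    derivative ℂ (mk (hMat (diagonal x))) =
      (∑ i, mk fun m => x i ^ (m + 1)) * mk (hMat (diagonal x)) := by
  ext k
  rw [coeff_derivative, coeff_mk, mul_comm, hMat_succ, coeff_mul,
    Finset.Nat.sum_antidiagonal_eq_sum_range_succ_mk]
  refine Finset.sum_congr rfl fun m _ => ?_
  simp [diagonal_pow, trace]

theorem mk_hMat_mul_prod {N : ℕ} (x : Fin N → ℂ) :
    mk (hMat (diagonal x)) * ∏ i, (1 - C (x i) * X) = 1 := by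
  refine derivative.ext ?_ ?_
  · rw [Derivation.leibniz, derivative_prod_one_sub, derivative_mk_hMat, Derivation.map_one_eq_zero]
    simp only [smul_eq_mul]
    ring
  · simp [hMat, map_prod]

theorem mk_hMat_mul_prod_erase {N : ℕ} (x : Fin N → ℂ) (k : Fin N) :
    mk (hMat (diagonal x)) * ∏ i ∈ Finset.univ.erase k, (1 - C (x i) * X) =
      mk fun m => x k ^ m := by
  have h : (1 - C (x k) * X : PowerSeries ℂ) ≠ 0 := right_ne_zero_of_mul_eq_one
    (mk_pow_mul_one_sub (x k))
  refine mul_right_cancel₀ h ?_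
  rw [mk_pow_mul_one_sub, mul_assoc, Finset.prod_erase_mul _ _ (Finset.mem_univ k),
    mk_hMat_mul_prod]

theorem pow_eq_sum_hMatZ {N : ℕ} (x : Fin N → ℂ) (k : Fin N) (n : ℕ) :
    x k ^ n = ∑ j : Fin N, coeff j.rev (∏ i ∈ Finset.univ.erase k, (1 - C (x i) * X)) *
      hMatZ (diagonal x) ((n : ℤ) - j.rev) := by
  set E := ∏ i ∈ Finset.univ.erase k, (1 - C (x i) * X : PowerSeries ℂ) with hE
  have h := congrArg (coeff n) (mk_hMat_mul_prod_erase x k)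
  rw [coeff_mk, mul_comm, coeff_mul, Finset.Nat.sum_antidiagonal_eq_sum_range_succ_mk] at h
  have hr : ∑ j : Fin N, coeff j.rev E * hMatZ (diagonal x) ((n : ℤ) - j.rev) =
      ∑ j : Fin N, coeff j E * hMatZ (diagonal x) ((n : ℤ) - j) :=
    Equiv.sum_comp Fin.revPerm fun j : Fin N => coeff j E * hMatZ (diagonal x) ((n : ℤ) - j)
  rw [← h, hr, Fin.sum_univ_eq_sum_range fun j => coeff j E *
    hMatZ (diagonal x) ((n : ℤ) - j)]
  have h1 : ∀ m ∈ Finset.range (n + 1), coeff m E * coeff (n - m) (mk (hMat (diagonal x))) =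
      coeff m E * hMatZ (diagonal x) ((n : ℤ) - m) := by
    intro m hm
    rw [Finset.mem_range] at hm
    rw [coeff_mk, hMatZ, if_neg (by omega)]
    congr 2
    omega
  rw [Finset.sum_congr rfl h1]
  trans ∑ m ∈ Finset.range (n + 1 + N), coeff m E * hMatZ (diagonal x) ((n : ℤ) - m)
  · refine Finset.sum_subset (Finset.range_mono (by omega)) fun m _ hm => ?_
    rw [Finset.mem_range] at hm
    rw [hMatZ, if_pos (by omega), mul_zero]
  · refine (Finset.sum_subset (Finset.range_mono (by omega)) fun m _ hm => ?_).symm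
    rw [Finset.mem_range] at hm
    rw [hE, coeff_prod_one_sub_eq_zero, zero_mul]
    rw [Finset.card_erase_of_mem (Finset.mem_univ k), Finset.card_univ, Fintype.card_fin]
    have := k.2
    omega

theorem schur_zero {N : ℕ} (X : Matrix (Fin N) (Fin N) ℂ) : schur (fun _ => 0) X = 1 := by
  rw [schur, det_of_isUpperTriangular]
  · refine Finset.prod_eq_one fun i _ => ?_
    simp [hMatZ, hMat]
  · intro i j hij
    have : (j : ℕ) < i := hij
    rw [of_apply, hMatZ, if_pos (by omega)]

theorem exists_alternant_eq {N : ℕ} (x : Fin N → ℂ) :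
    ∃ e : ℂ, ∀ l : Fin N → ℕ,
      (Matrix.of fun i j => x i ^ (l j + j.rev : ℕ)).det = e * schur l (diagonal x) := by
  refine ⟨(Matrix.of fun k j : Fin N => coeff j.rev
    (∏ i ∈ Finset.univ.erase k, (1 - C (x i) * X))).det, fun l => ?_⟩
  rw [schur, ← det_transpose (Matrix.of fun i j : Fin N => hMatZ _ _), ← det_mul]
  congr 1
  ext k i
  rw [of_apply, pow_eq_sum_hMatZ, mul_apply]
  refine Finset.sum_congr rfl fun j _ => ?_
  rw [of_apply, transpose_apply, of_apply]
  congr 2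
  simp only [Fin.val_rev]
  have := i.2
  have := j.2
  push_cast
  omega

/-- The Jacobi–Trudi identity. -/
theorem alternant_eq {N : ℕ} (l : Fin N → ℕ) (x : Fin N → ℂ) :
    (Matrix.of fun i j => x i ^ (l j + j.rev : ℕ)).det =
      (Equiv.Perm.sign (Fin.revPerm : Equiv.Perm (Fin N)) : ℂ) * (vandermonde x).det *
        schur l (diagonal x) := by
  obtain ⟨e, he⟩ := exists_alternant_eq x
  have h0 := he fun _ => 0
  rw [schur_zero, mul_one] at h0
  rw [he, ← h0, ← det_permute']
  congr 2
  ext i j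
  simp [vandermonde_apply]

end JacobiTrudi

theorem exists_ev_eq_hMat (N k : ℕ) :
    ∃ Q : MvPolynomial (Fin N × Fin N) ℂ, ∀ X, ev X Q = hMat X k := by
  induction k using Nat.strong_induction_on with
  | _ k ih =>
    match k with
    | 0 => exact ⟨1, fun X => by rw [map_one, hMat]⟩
    | k + 1 =>
      choose! Q hQ using ih
      refine ⟨MvPolynomial.C ((k : ℂ) + 1)⁻¹ * ∑ m ∈ Finset.range (k + 1),
        (mvPolynomialX (Fin N) (Fin N) ℂ ^ (m + 1)).trace * Q (k - m), fun X => ?_⟩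
      have hX : (ev X).mapMatrix (mvPolynomialX (Fin N) (Fin N) ℂ) = X := by
        ext i j
        simp
      rw [hMat, map_mul, ev_C, map_sum]
      congr 1
      refine Finset.sum_congr rfl fun m _ => ?_
      rw [map_mul, hQ _ (by omega), AddMonoidHom.map_trace, ← AlgHom.mapMatrix_apply, map_pow, hX]

theorem exists_ev_eq_schur {N : ℕ} (l : Fin N → ℕ) :
    ∃ Q : MvPolynomial (Fin N × Fin N) ℂ, ∀ X, ev X Q = schur l X := by
  have h : ∀ k : ℤ, ∃ Q : MvPolynomial (Fin N × Fin N) ℂ, ∀ X, ev X Q = hMatZ X k := by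
    intro k
    simp only [hMatZ]
    split_ifs
    · exact ⟨0, fun X => map_zero _⟩
    · exact exists_ev_eq_hMat N _
  choose Q hQ using h
  refine ⟨(Matrix.of fun i j : Fin N => Q ((l i : ℤ) - (i : ℤ) + (j : ℤ))).det, fun X => ?_⟩
  rw [AlgHom.map_det, schur]
  congr 1
  ext i j
  simp [hQ]

theorem hMat_mul_comm {N : ℕ} (A B : Matrix (Fin N) (Fin N) ℂ) (k : ℕ) :
    hMat (A * B) k = hMat (B * A) k := by
  induction k using Nat.strong_induction_on with
  | _ k ih =>
    match k with
    | 0 => rw [hMat, hMat]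
    | k + 1 =>
      rw [hMat, hMat]
      congr 1
      refine Finset.sum_congr rfl fun m _ => ?_
      rw [ih _ (by omega), pow_succ, ← mul_assoc, mul_pow_mul, trace_mul_comm, ← mul_assoc,
        ← pow_succ']

theorem schur_mul_comm {N : ℕ} (l : Fin N → ℕ) (A B : Matrix (Fin N) (Fin N) ℂ) :
    schur l (A * B) = schur l (B * A) := by
  simp only [schur, hMatZ, hMat_mul_comm A B]

/-- A conjugation invariant polynomial is determined by its values on diagonal matrices. -/
theorem eq_zero_of_diagonal {N : ℕ} (P : MvPolynomial (Fin N × Fin N) ℂ)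
    (hP : ∀ g X, ev (g * X) P = ev (X * g) P) (h : ∀ x, ev (diagonal x) P = 0) : P = 0 := by
  refine eq_zero_of_isHermitian P fun H hH => ?_
  have := hH.spectral_theorem
  rw [Unitary.conjStarAlgAut_apply] at this
  rw [this, hP, ← mul_assoc, mem_unitaryGroup_iff'.mp hH.eigenvectorUnitary.2, one_mul]
  exact h _

/-- Normalized Schur functions are spherical. -/
theorem IsSpherical.exists_ev_eq_mul_schur {N : ℕ} {μ : Measure (UN N)} [μ.IsHaarMeasure]
    [IsProbabilityMeasure μ] {c l : Fin N → ℕ}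
    (hl : ∀ i, l i = ∑ m ∈ Finset.Ici i, c m) {P : MvPolynomial (Fin N × Fin N) ℂ}
    (h : IsSpherical μ c P) : ∃ k : ℂ, ∀ X, ev X P = k * schur l X := by
  obtain ⟨k, hk⟩ := h.exists_van_mul_eq hl
  obtain ⟨Q, hQ⟩ := exists_ev_eq_schur l
  refine ⟨k * (Equiv.Perm.sign (Fin.revPerm : Equiv.Perm (Fin N)) : ℂ), fun X => ?_⟩
  generalize hk' : k * (Equiv.Perm.sign (Fin.revPerm : Equiv.Perm (Fin N)) : ℂ) = k'
  have hdiag : diagSub P = diagSub (MvPolynomial.C k' * Q) := by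
    refine eq_of_aeval_injective fun x hx => ?_
    refine mul_left_cancel₀ (det_vandermonde_ne_zero_iff.mpr hx) ?_
    rw [eval_diagSub, eval_diagSub, hk, alternant_eq, map_mul, ev_C, hQ, ← hk']
    ring
  have hz : P - MvPolynomial.C k' * Q = 0 := by
    refine eq_zero_of_diagonal _ (fun g X => ?_) fun x => ?_
    · rw [map_sub, map_sub, map_mul, map_mul, h.ev_mul_comm, hQ, hQ, schur_mul_comm l g, ev_C, ev_C]
    · rw [← eval_diagSub, map_sub, hdiag, sub_self, map_zero]
  rw [sub_eq_zero.mp hz, map_mul, ev_C, hQ]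

theorem integral_schur_conj_mul {N : ℕ} (l : Fin N → ℕ) (hl : Antitone l) (μ : Measure (UN N))
    [μ.IsHaarMeasure] [IsProbabilityMeasure μ] (A B : Matrix (Fin N) (Fin N) ℂ) :
    ∫ U : UN N, schur l ((U : Matrix (Fin N) (Fin N) ℂ) * A *
      star (U : Matrix (Fin N) (Fin N) ℂ) * B) ∂μ = schur l A * schur l B / schur l 1 := by
  obtain ⟨c, hc⟩ := exists_layers l hl
  obtain ⟨P, hP⟩ := exists_isSpherical μ c
  obtain ⟨k, hk⟩ := hP.exists_ev_eq_mul_schur hc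
  have h1 : k * schur l 1 = 1 := by rw [← hk, hP.ev_one]
  have hI := hP.integral_conj_mul A B
  simp only [hk, integral_const_mul] at hI
  rw [eq_div_iff (right_ne_zero_of_mul_eq_one h1)]
  refine mul_left_cancel₀ (left_ne_zero_of_mul_eq_one h1) ?_
  rw [← mul_assoc, hI]
  linear_combination k * schur l A * schur l B * h1

/-- An integrand of nonzero homogeneity under unit scalars has vanishing integral. -/
theorem integral_mul_det_zpow_eq_zero {N : ℕ} (hN : N ≠ 0) (μ : Measure (UN N)) [μ.IsHaarMeasure]
    (q : ℤ) (hq : q ≠ 0) (f : Matrix (Fin N) (Fin N) ℂ → ℂ) (A B : Matrix (Fin N) (Fin N) ℂ) :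
    ∫ U : UN N, f ((U : Matrix (Fin N) (Fin N) ℂ) * A *
      star (U : Matrix (Fin N) (Fin N) ℂ) * B) * (U : Matrix (Fin N) (Fin N) ℂ).det ^ q ∂μ = 0 := by
  set θ : ℝ := Real.pi / (N * q) with hθ
  set ζ : ℂ := Complex.exp (θ * Complex.I) with hζ
  have hζ1 : ζ * star ζ = 1 := by
    rw [← starRingEnd_apply, Complex.mul_conj, Complex.normSq_eq_norm_sq,
      Complex.norm_exp_ofReal_mul_I]
    simp
  have hζq : (ζ ^ N) ^ q = -1 := by
    rw [hζ, ← Complex.exp_nat_mul, ← Complex.exp_int_mul, ← Complex.exp_pi_mul_I, hθ]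
    congr 1
    push_cast
    have : (N : ℂ) ≠ 0 := Nat.cast_ne_zero.mpr hN
    have : (q : ℂ) ≠ 0 := Int.cast_ne_zero.mpr hq
    field_simp
  have hZ : ζ • (1 : Matrix (Fin N) (Fin N) ℂ) ∈ unitaryGroup (Fin N) ℂ := by
    rw [mem_unitaryGroup_iff, star_smul, star_one, smul_mul_smul_comm, hζ1, one_mul, one_smul]
  have h := integral_mul_left_eq_self (μ := μ) (fun U : UN N =>
    f ((U : Matrix (Fin N) (Fin N) ℂ) * A * star (U : Matrix (Fin N) (Fin N) ℂ) * B) *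
      (U : Matrix (Fin N) (Fin N) ℂ).det ^ q) ⟨_, hZ⟩
  have h2 : ∀ U : Matrix (Fin N) (Fin N) ℂ, ζ • (U * A * star (ζ • U) * B) = U * A * star U * B := by
    intro U
    rw [star_smul, mul_smul_comm, smul_mul_assoc, smul_smul, hζ1, one_smul]
  simp only [Submonoid.coe_mul, smul_mul_assoc, one_mul] at h
  simp only [h2, det_smul, Fintype.card_fin, mul_zpow, hζq, neg_mul, one_mul, mul_neg,
    integral_neg] at h
  exact self_eq_neg.mp h.symm

/-- `∫_{U(N)} s_λ(UAU†B) (det U)^q d_*U = δ_{q,0} s_λ(A)s_λ(B)/s_λ(I_N)`. -/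
theorem statement6 {N : ℕ} (hN : 1 ≤ N)
    (A B : Matrix (Fin N) (Fin N) ℂ)
    (l : Fin N → ℕ) (hl : Antitone l) (q : ℤ)
    (μ : Measure (UN N)) [μ.IsHaarMeasure] [IsProbabilityMeasure μ] :
    (∫ U : UN N,
        schur l ((U : Matrix (Fin N) (Fin N) ℂ) * A * star (U : Matrix (Fin N) (Fin N) ℂ) * B) *
          ((U : Matrix (Fin N) (Fin N) ℂ).det) ^ q ∂μ) =
      if q = 0 then schur l A * schur l B / schur l (1 : Matrix (Fin N) (Fin N) ℂ) else 0 := by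
  split_ifs with hq
  · subst hq
    simp only [zpow_zero, mul_one]
    exact integral_schur_conj_mul l hl μ A B
  · exact integral_mul_det_zpow_eq_zero (by omega) μ q hq (schur l) A B

end
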